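/- arXiv:1704.02453 — 4 statements merged into one kernel-verified Lean document; each statement's English description precedes it below -/
import Mathlib

section
/- An ABC ranking rule F is an ABC counting rule if and only if F satisfies symmetry, consistency, weak efficiency, and continuity. -/
namespace ABC

/-- An approval profile: a list of approval ballots (one per voter),
each ballot a subset of the candidate set `Fin m`. -/
abbrev Profile (m : ℕ) := List (Finset (Fin m))

/-- `n`-fold concatenation of a profile with itself. -/
def nCopies {m : ℕ} (n : ℕ) (A : Profile m) : Profile m := (List.replicate n A).flatten

/-- A counting function `f : {0,…,k} × {0,…,m} → ℝ`, weakly increasing in the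
first coordinate. -/
def IsCountingFunction (m k : ℕ) (f : ℕ → ℕ → ℝ) : Prop :=
  ∀ x x' y : ℕ, x' ≤ x → x ≤ k → y ≤ m → f x' y ≤ f x y

/-- The `f`-score of a committee `W` in a profile `A`. -/
noncomputable def score {m : ℕ} (f : ℕ → ℕ → ℝ) (W : Finset (Fin m)) (A : Profile m) : ℝ :=
  (A.map (fun s => f (s ∩ W).card s.card)).sum

/-- An ABC ranking rule: a weak order (complete, transitive) on committees
(size-`k` subsets of the `m` candidates) for every approval profile. -/
structure ABCRankingRule (m k : ℕ) where
  rel : Profile m → Finset (Fin m) → Finset (Fin m) → Prop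
  total : ∀ A W1 W2, W1.card = k → W2.card = k → rel A W1 W2 ∨ rel A W2 W1
  trans : ∀ A W1 W2 W3, W1.card = k → W2.card = k → W3.card = k →
    rel A W1 W2 → rel A W2 W3 → rel A W1 W3

/-- The strict part of a (weak) relation on committees. -/
def strictOf {ρ : Type} {m : ℕ} (rel : ρ → Finset (Fin m) → Finset (Fin m) → Prop)
    (A : ρ) (W1 W2 : Finset (Fin m)) : Prop :=
  rel A W1 W2 ∧ ¬ rel A W2 W1

def ABCRankingRule.strict {m k : ℕ} (F : ABCRankingRule m k) :
    Profile m → Finset (Fin m) → Finset (Fin m) → Prop :=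
  strictOf F.rel

/-- Anonymity: the outcome depends only on the multiset of ballots. -/
def Anonymous (m k : ℕ) (rel : Profile m → Finset (Fin m) → Finset (Fin m) → Prop) : Prop :=
  ∀ A A' : Profile m, A.Perm A' → ∀ W1 W2 : Finset (Fin m), W1.card = k → W2.card = k →
    (rel A W1 W2 ↔ rel A' W1 W2)

/-- Neutrality: renaming candidates by a permutation renames the outcome accordingly. -/
def Neutral (m k : ℕ) (rel : Profile m → Finset (Fin m) → Finset (Fin m) → Prop) : Prop :=
  ∀ (σ : Equiv.Perm (Fin m)) (A : Profile m) (W1 W2 : Finset (Fin m)),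
    W1.card = k → W2.card = k →
    (rel A W1 W2 ↔ rel (A.map (fun s => s.image σ)) (W1.image σ) (W2.image σ))

/-- Consistency for ABC ranking rules. -/
def Consistent (m k : ℕ) (rel : Profile m → Finset (Fin m) → Finset (Fin m) → Prop) : Prop :=
  ∀ (A A' : Profile m) (W1 W2 : Finset (Fin m)), W1.card = k → W2.card = k →
    (strictOf rel A W1 W2 → rel A' W1 W2 → strictOf rel (A ++ A') W1 W2) ∧
    (rel A W1 W2 → rel A' W1 W2 → rel (A ++ A') W1 W2)

/-- Weak efficiency: if no voter approves any candidate of `W2 \ W1` then `W1 ⪰ W2`. -/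
def WeakEfficient (m k : ℕ) (rel : Profile m → Finset (Fin m) → Finset (Fin m) → Prop) : Prop :=
  ∀ (A : Profile m) (W1 W2 : Finset (Fin m)), W1.card = k → W2.card = k →
    (∀ s ∈ A, ∀ c ∈ W2, c ∉ W1 → c ∉ s) → rel A W1 W2

/-- Efficiency: if every voter approves at least as many members of `W1` as of `W2`
then `W1 ⪰ W2`. -/
def Efficient (m k : ℕ) (rel : Profile m → Finset (Fin m) → Finset (Fin m) → Prop) : Prop :=
  ∀ (A : Profile m) (W1 W2 : Finset (Fin m)), W1.card = k → W2.card = k →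
    (∀ s ∈ A, (s ∩ W2).card ≤ (s ∩ W1).card) → rel A W1 W2

/-- Continuity for ABC ranking rules. -/
def Continuous (m k : ℕ) (rel : Profile m → Finset (Fin m) → Finset (Fin m) → Prop) : Prop :=
  ∀ (A A' : Profile m) (W1 W2 : Finset (Fin m)), W1.card = k → W2.card = k →
    strictOf rel A' W1 W2 → ∃ n : ℕ, strictOf rel (A ++ nCopies n A') W1 W2

/-- A counting function `f` implements an ABC ranking rule `F`. -/
def Implements (m k : ℕ) (f : ℕ → ℕ → ℝ) (F : ABCRankingRule m k) : Prop :=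
  ∀ (A : Profile m) (W1 W2 : Finset (Fin m)), W1.card = k → W2.card = k →
    (score f W2 A < score f W1 A ↔ F.strict A W1 W2)

/-- `F` is an ABC counting rule: some counting function implements it. -/
def IsCountingRule (m k : ℕ) (F : ABCRankingRule m k) : Prop :=
  ∃ f : ℕ → ℕ → ℝ, IsCountingFunction m k f ∧ Implements m k f F

/-- `W` is a winning committee in `F(A)`: it is a maximal element of the weak order. -/
def Winning (m k : ℕ) (F : ABCRankingRule m k) (A : Profile m) (W : Finset (Fin m)) : Prop :=
  W.card = k ∧ ∀ W' : Finset (Fin m), W'.card = k → F.rel A W W'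

/-- `A` is a party-list profile with `p` parties with approval sets `Cs 0, …, Cs (p-1)`:
the `Cs i` are pairwise disjoint nonempty sets, every ballot equals some `Cs i`,
and each party has at least one voter. -/
def IsPartyList (m : ℕ) (A : Profile m) (p : ℕ) (Cs : Fin p → Finset (Fin m)) : Prop :=
  (∀ i, (Cs i).Nonempty) ∧
  (∀ i j, i ≠ j → Disjoint (Cs i) (Cs j)) ∧
  (∀ s ∈ A, ∃ i, s = Cs i) ∧
  (∀ i, Cs i ∈ A)

/-- The number `|N_i|` of voters of party `i`. -/
def partySize {m : ℕ} (A : Profile m) {p : ℕ} (Cs : Fin p → Finset (Fin m)) (i : Fin p) : ℕ :=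
  A.count (Cs i)

/-- `W` is D'Hondt proportional for the party-list profile `A`:
for all parties `i, j`: `C_j ⊆ W`, or `W ∩ C_i = ∅`, or
`|N_i|/|W∩C_i| ≥ |N_j|/(|W∩C_j|+1)` (stated cross-multiplied). -/
def DHondtProportionalFor (m : ℕ) (A : Profile m) (p : ℕ) (Cs : Fin p → Finset (Fin m))
    (W : Finset (Fin m)) : Prop :=
  ∀ i j : Fin p,
    Cs j ⊆ W ∨ W ∩ Cs i = ∅ ∨
    partySize A Cs j * (W ∩ Cs i).card ≤ partySize A Cs i * ((W ∩ Cs j).card + 1)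

/-- D'Hondt proportionality for ABC ranking rules. -/
def DHondtProp (m k : ℕ) (F : ABCRankingRule m k) : Prop :=
  ∀ (A : Profile m) (p : ℕ) (Cs : Fin p → Finset (Fin m)), IsPartyList m A p Cs →
    ∀ W : Finset (Fin m), W.card = k →
      (Winning m k F A W ↔ DHondtProportionalFor m A p Cs W)

/-- The PAV counting function `f_PAV(x,y) = Σ_{i=1}^{x} 1/i`. -/
noncomputable def fPAV : ℕ → ℕ → ℝ := fun x _ => ∑ i ∈ Finset.range x, (1 : ℝ) / (i + 1)

/-- The AV counting function `f_AV(x,y) = x`. -/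
def fAV : ℕ → ℕ → ℝ := fun x _ => (x : ℝ)

/-- The Chamberlin–Courant counting function. -/
noncomputable def fCC : ℕ → ℕ → ℝ := fun x _ => if x = 0 then 0 else 1

/-- The union of all approval sets in a profile. -/
def profileUnion {m : ℕ} (A : Profile m) : Finset (Fin m) := A.foldr (· ∪ ·) ∅

/-- Disjoint equality for ABC ranking rules. -/
def DisjointEquality (m k : ℕ) (F : ABCRankingRule m k) : Prop :=
  ∀ A : Profile m,
    (∀ c : Fin m, A.countP (fun s => decide (c ∈ s)) ≤ 1) →
    k ≤ (profileUnion A).card →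
    ∀ W : Finset (Fin m), W.card = k →
      (Winning m k F A W ↔ W ⊆ profileUnion A)

/-- Disjoint diversity for ABC ranking rules, stated for party-list profiles whose
parties are indexed in order of weakly decreasing size. -/
def DisjointDiversity (m k : ℕ) (F : ABCRankingRule m k) : Prop :=
  ∀ (A : Profile m) (p : ℕ) (Cs : Fin p → Finset (Fin m)), IsPartyList m A p Cs →
    (∀ i j : Fin p, i ≤ j → partySize A Cs j ≤ partySize A Cs i) →
    ∃ W : Finset (Fin m), Winning m k F A W ∧
      ∀ i : Fin p, (i : ℕ) < k → (W ∩ Cs i).Nonempty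

/-- Lower quota for ABC ranking rules. -/
def LowerQuota (m k : ℕ) (F : ABCRankingRule m k) : Prop :=
  ∀ (A : Profile m) (p : ℕ) (Cs : Fin p → Finset (Fin m)), IsPartyList m A p Cs →
    ∀ W : Finset (Fin m), Winning m k F A W →
      ∀ i : Fin p,
        k * partySize A Cs i / A.length ≤ (W ∩ Cs i).card ∨
        (Cs i).card < k * partySize A Cs i / A.length

/-- A trivial ABC ranking rule declares all committees tied on all profiles. -/
def IsTrivialRule (m k : ℕ) (F : ABCRankingRule m k) : Prop :=
  ∀ (A : Profile m) (W1 W2 : Finset (Fin m)), W1.card = k → W2.card = k → F.rel A W1 W2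

/-- An `ℓ`-regular profile: every voter approves exactly `ℓ` candidates. -/
def IsRegular (m ℓ : ℕ) (A : Profile m) : Prop := ∀ s ∈ A, s.card = ℓ

/- ### Linear-order (LOC) profiles -/

/-- A profile of linear orders: each voter's ranking is a bijection sending a
candidate to its position (position `0` is the top). -/
abbrev LProfile (m : ℕ) := List (Fin m ≃ Fin m)

def nCopiesL {m : ℕ} (n : ℕ) (P : LProfile m) : LProfile m := (List.replicate n P).flatten

/-- The set of a voter's top `ℓ` candidates. -/
def apprTop (m ℓ : ℕ) (r : Fin m ≃ Fin m) : Finset (Fin m) :=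
  Finset.univ.filter (fun c => (r c : ℕ) < ℓ)

/-- `Appr(P, ℓ)`: the approval profile in which each voter approves her top `ℓ`
candidates. -/
def ApprProfile (m ℓ : ℕ) (P : LProfile m) : Profile m := P.map (apprTop m ℓ)

def LAnonymous (m k : ℕ) (rel : LProfile m → Finset (Fin m) → Finset (Fin m) → Prop) : Prop :=
  ∀ P P' : LProfile m, P.Perm P' → ∀ W1 W2 : Finset (Fin m), W1.card = k → W2.card = k →
    (rel P W1 W2 ↔ rel P' W1 W2)

def LNeutral (m k : ℕ) (rel : LProfile m → Finset (Fin m) → Finset (Fin m) → Prop) : Prop :=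
  ∀ (σ : Equiv.Perm (Fin m)) (P : LProfile m) (W1 W2 : Finset (Fin m)),
    W1.card = k → W2.card = k →
    (rel P W1 W2 ↔ rel (P.map (fun r => σ.symm.trans r)) (W1.image σ) (W2.image σ))

def LConsistent (m k : ℕ) (rel : LProfile m → Finset (Fin m) → Finset (Fin m) → Prop) : Prop :=
  ∀ (P P' : LProfile m) (W1 W2 : Finset (Fin m)), W1.card = k → W2.card = k →
    (strictOf rel P W1 W2 → rel P' W1 W2 → strictOf rel (P ++ P') W1 W2) ∧
    (rel P W1 W2 → rel P' W1 W2 → rel (P ++ P') W1 W2)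

def LContinuous (m k : ℕ) (rel : LProfile m → Finset (Fin m) → Finset (Fin m) → Prop) : Prop :=
  ∀ (P P' : LProfile m) (W1 W2 : Finset (Fin m)), W1.card = k → W2.card = k →
    strictOf rel P' W1 W2 → ∃ n : ℕ, strictOf rel (P ++ nCopiesL n P') W1 W2

/-- `I` dominates `J`: sorted increasingly, the `t`-th element of `I` is at most
the `t`-th element of `J`. -/
def dominatesPos (m : ℕ) (I J : Finset (Fin m)) : Prop :=
  List.Forall₂ (· ≤ ·) (I.sort (· ≤ ·)) (J.sort (· ≤ ·))

/-- Committee dominance for LOC ranking rules. -/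
def LCommitteeDominance (m k : ℕ)
    (rel : LProfile m → Finset (Fin m) → Finset (Fin m) → Prop) : Prop :=
  ∀ (P : LProfile m) (W1 W2 : Finset (Fin m)), W1.card = k → W2.card = k →
    (∀ r ∈ P, dominatesPos m (W1.image ⇑r) (W2.image ⇑r)) → rel P W1 W2

/- ### ABC choice rules -/

/-- An ABC choice rule: a nonempty set of winning committees for every profile. -/
structure ABCChoiceRule (m k : ℕ) where
  choice : Profile m → Set (Finset (Fin m))
  nonempty : ∀ A, (choice A).Nonempty
  card_eq : ∀ A W, W ∈ choice A → W.card = k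

def CAnonymous (m k : ℕ) (R : ABCChoiceRule m k) : Prop :=
  ∀ A A' : Profile m, A.Perm A' → R.choice A = R.choice A'

def CNeutral (m k : ℕ) (R : ABCChoiceRule m k) : Prop :=
  ∀ (σ : Equiv.Perm (Fin m)) (A : Profile m),
    R.choice (A.map (fun s => s.image σ)) = (fun W : Finset (Fin m) => W.image σ) '' R.choice A

def CConsistent (m k : ℕ) (R : ABCChoiceRule m k) : Prop :=
  ∀ A A' : Profile m, (R.choice A ∩ R.choice A').Nonempty →
    R.choice (A ++ A') = R.choice A ∩ R.choice A'

def CContinuous (m k : ℕ) (R : ABCChoiceRule m k) : Prop :=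
  ∀ A A' : Profile m, R.choice A ∩ R.choice A' = ∅ →
    ∃ n : ℕ, R.choice (A ++ nCopies n A') ⊆ R.choice A'

def CWeakEfficient (m k : ℕ) (R : ABCChoiceRule m k) : Prop :=
  ∀ (A : Profile m) (W : Finset (Fin m)), W ∈ R.choice A →
    ∀ c ∈ W, (∀ s ∈ A, c ∉ s) →
      ∀ c' : Fin m, c' ∉ W → insert c' (W.erase c) ∈ R.choice A

def TwoNonimposition (m k : ℕ) (R : ABCChoiceRule m k) : Prop :=
  ∀ W1 W2 : Finset (Fin m), W1.card = k → W2.card = k →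
    ∃ B : Profile m, R.choice B = {W1, W2}

/-- The ranking-side relation `F_R` induced by a choice rule `R` and a map `α`. -/
def relFR (m k : ℕ) (R : ABCChoiceRule m k)
    (α : Finset (Fin m) → Finset (Fin m) → Profile m)
    (A : Profile m) (W1 W2 : Finset (Fin m)) : Prop :=
  ∃ n : ℕ, ∀ n' ≥ n, W1 ∈ R.choice (A ++ nCopies n' (α W1 W2))

def CDHondtProp (m k : ℕ) (R : ABCChoiceRule m k) : Prop :=
  ∀ (A : Profile m) (p : ℕ) (Cs : Fin p → Finset (Fin m)), IsPartyList m A p Cs →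
    ∀ W : Finset (Fin m), W.card = k →
      (W ∈ R.choice A ↔ DHondtProportionalFor m A p Cs W)

def CDisjointDiversity (m k : ℕ) (R : ABCChoiceRule m k) : Prop :=
  ∀ (A : Profile m) (p : ℕ) (Cs : Fin p → Finset (Fin m)), IsPartyList m A p Cs →
    (∀ i j : Fin p, i ≤ j → partySize A Cs j ≤ partySize A Cs i) →
    ∃ W ∈ R.choice A, ∀ i : Fin p, (i : ℕ) < k → (W ∩ Cs i).Nonempty

/-- A trivial ABC choice rule returns all committees on every profile. -/
def CTrivial (m k : ℕ) (R : ABCChoiceRule m k) : Prop :=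
  ∀ A : Profile m, R.choice A = {W : Finset (Fin m) | W.card = k}


/-- An additive, Archimedean notion of nonnegativity on multisets, total with respect to an
involution that exchanges the two signs, is given by the sign of a real-valued weight. -/
theorem exists_weight_of_nonneg {α : Type} (R : Multiset α → Prop) (τ : α → α)
    (hτ : Function.Involutive τ) (total : ∀ s, R s ∨ R (s.map τ))
    (add : ∀ s t, R s → R t → R (s + t))
    (add_strict : ∀ s t, ¬ R (s.map τ) → R t → ¬ R ((s + t).map τ))
    (arch : ∀ s t : Multiset α, ¬ R (s.map τ) → ∃ n : ℕ, ¬ R ((t + n • s).map τ)) :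
    ∃ v : α → ℝ, (∀ a, v (τ a) = -v a) ∧ ∀ s, R s ↔ 0 ≤ (s.map v).sum := by
  classical
  have hmm (s : Multiset α) : (s.map τ).map τ = s := by
    simp [Multiset.map_map, hτ _]
  have self_add (s : Multiset α) : R (s + s.map τ) := by
    rcases total (s + s.map τ) with h | h
    · exact h
    · rwa [Multiset.map_add, hmm, add_comm] at h
  have cancel (s u : Multiset α) : R (s + (u + u.map τ)) ↔ R s := by
    refine ⟨fun h => ?_, fun h => add _ _ h (self_add u)⟩
    by_contra hs
    have h1 := add_strict (s.map τ) (u + u.map τ) (by rwa [hmm]) (self_add u)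
    rw [Multiset.map_add, hmm, Multiset.map_add, hmm, add_comm (u.map τ)] at h1
    exact h1 h
  have trans' (s t w : Multiset α) (h1 : R (t + s.map τ)) (h2 : R (w + t.map τ)) :
      R (w + s.map τ) := by
    rw [← cancel _ t]
    convert add _ _ h1 h2 using 1
    abel
  have add_right (s t w : Multiset α) :
      R ((t + w) + (s + w).map τ) ↔ R (t + s.map τ) := by
    rw [← cancel (t + s.map τ) w, Multiset.map_add]
    apply iff_of_eq
    congr 1
    abel
  let c : AddCon (Multiset α) :=
    { r := fun s t => R (s + t.map τ) ∧ R (t + s.map τ)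
      iseqv := ⟨fun s => ⟨self_add s, self_add s⟩, fun h => ⟨h.2, h.1⟩,
        fun h h' => ⟨trans' _ _ _ h'.1 h.1, trans' _ _ _ h.2 h'.2⟩⟩
      add' := by
        intro w x y z h h'
        have key : ∀ w x y z : Multiset α, R (w + x.map τ) → R (y + z.map τ) →
            R ((w + y) + (x + z).map τ) := by
          intro w x y z h h'
          rw [Multiset.map_add]
          convert add _ _ h h' using 1
          abel
        exact ⟨key _ _ _ _ h.1 h'.1, key _ _ _ _ h.2 h'.2⟩ }
  have hc (s t : Multiset α) : (s : c.Quotient) = t ↔ R (s + t.map τ) ∧ R (t + s.map τ) :=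
    c.eq
  let : Neg c.Quotient := ⟨Quotient.map' (fun s => s.map τ) (by
        intro s t h
        refine ⟨?_, ?_⟩
        · show R (s.map τ + (t.map τ).map τ)
          rw [hmm, add_comm]; exact h.2
        · show R (t.map τ + (s.map τ).map τ)
          rw [hmm, add_comm]; exact h.1)⟩
  let : AddCommGroup c.Quotient :=
    { (inferInstance : AddCommMonoid c.Quotient), (inferInstance : Neg c.Quotient) with
      zsmul := zsmulRec
      neg_add_cancel := by
        intro x
        induction x using AddCon.induction_on with | _ s =>
        show ((s.map τ + s : Multiset α) : c.Quotient) = ((0 : Multiset α) : c.Quotient)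
        rw [hc]
        constructor
        · simpa [add_comm] using self_add s
        · simpa [hmm, add_comm] using self_add s }
  let : LE c.Quotient := ⟨fun x y => AddCon.liftOn₂ x y (fun s t => R (t + s.map τ)) (by
    intro s t s' t' h h'
    apply propext
    exact ⟨fun H => trans' _ _ _ (trans' _ _ _ h.1 H) h'.2,
      fun H => trans' _ _ _ (trans' _ _ _ h.2 H) h'.1⟩)⟩
  have hle (s t : Multiset α) : (s : c.Quotient) ≤ t ↔ R (t + s.map τ) := Iff.rfl
  let : LinearOrder c.Quotient :=
    { le_refl := by
        intro x
        induction x using AddCon.induction_on with | _ s => exact self_add s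
      le_trans := by
        intro x y z
        induction x using AddCon.induction_on with | _ s =>
        induction y using AddCon.induction_on with | _ t =>
        induction z using AddCon.induction_on with | _ w => exact fun h h' => trans' s t w h h'
      le_antisymm := by
        intro x y
        induction x using AddCon.induction_on with | _ s =>
        induction y using AddCon.induction_on with | _ t =>
        exact fun h h' => (hc s t).2 ⟨h', h⟩
      le_total := by
        intro x y
        induction x using AddCon.induction_on with | _ s =>
        induction y using AddCon.induction_on with | _ t =>
        rw [hle, hle]
        have h := total (t + s.map τ)
        rwa [Multiset.map_add, hmm, add_comm (t.map τ)] at h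
      toDecidableLE := Classical.decRel _ }
  have : IsOrderedAddMonoid c.Quotient :=
    { add_le_add_left := by
        intro x y h z
        induction x using AddCon.induction_on with | _ s =>
        induction y using AddCon.induction_on with | _ t =>
        induction z using AddCon.induction_on with | _ w =>
        rw [hle] at h
        rw [← AddCon.coe_add, ← AddCon.coe_add, hle]
        exact (add_right s t w).2 h }
  have : Archimedean c.Quotient := ⟨by
    intro x y hy
    induction x using AddCon.induction_on with | _ s =>
    induction y using AddCon.induction_on with | _ t =>
    have hy' : ¬ R (t.map τ) := by
      have : ¬ ((t : c.Quotient) ≤ ((0 : Multiset α) : c.Quotient)) := not_le.2 hy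
      rw [hle] at this
      simpa using this
    obtain ⟨n, hn⟩ := arch t (s.map τ) hy'
    refine ⟨n, ?_⟩
    have h := (total (s.map τ + n • t)).resolve_right hn
    rw [add_comm] at h
    exact h⟩
  obtain ⟨f, hf⟩ := Archimedean.exists_orderAddMonoidHom_real_injective c.Quotient
  refine ⟨fun a => f (({a} : Multiset α) : c.Quotient), fun a => ?_, fun s => ?_⟩
  · have h : (({τ a} : Multiset α) : c.Quotient) = -(({a} : Multiset α) : c.Quotient) := rfl
    exact (congrArg f h).trans (map_neg f _)
  have hsum : (s.map fun a => f (({a} : Multiset α) : c.Quotient)).sum = f (s : c.Quotient) := by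
    induction s using Multiset.induction with
    | empty => simp
    | cons a s ih =>
      rw [Multiset.map_cons, Multiset.sum_cons, ih, ← Multiset.singleton_add, AddCon.coe_add,
        map_add]
  have hmono : StrictMono f := (OrderHomClass.mono f).strictMono_of_injective hf
  rw [hsum, ← map_zero f, hmono.le_iff_le]
  have : (0 : c.Quotient) ≤ s ↔ R (s + (0 : Multiset α).map τ) := Iff.rfl
  rw [this]
  simp

section Score

variable {m : ℕ} (f : ℕ → ℕ → ℝ)

@[simp] theorem nCopies_zero (A : Profile m) : nCopies 0 A = [] := rfl

theorem nCopies_succ (n : ℕ) (A : Profile m) : nCopies (n + 1) A = A ++ nCopies n A := by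
  simp [nCopies, List.replicate_succ]

@[simp] theorem score_nil (W : Finset (Fin m)) : score f W [] = 0 := rfl

@[simp] theorem score_cons (W s : Finset (Fin m)) (A : Profile m) :
    score f W (s :: A) = f (s ∩ W).card s.card + score f W A := rfl

@[simp] theorem score_append (W : Finset (Fin m)) (A B : Profile m) :
    score f W (A ++ B) = score f W A + score f W B := by
  simp [score]

@[simp] theorem score_nCopies (W : Finset (Fin m)) (n : ℕ) (A : Profile m) :
    score f W (nCopies n A) = n * score f W A := by
  induction n with
  | zero => simp
  | succ n ih =>
    rw [nCopies_succ, score_append, ih]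
    push_cast
    ring

theorem score_perm (W : Finset (Fin m)) {A B : Profile m} (h : A.Perm B) :
    score f W A = score f W B :=
  (h.map _).sum_eq

@[simp] theorem score_image (σ : Equiv.Perm (Fin m)) (W : Finset (Fin m)) (A : Profile m) :
    score f (W.image σ) (A.map fun s => s.image σ) = score f W A := by
  simp only [score, List.map_map]
  congr 2
  funext s
  simp [← Finset.image_inter _ _ σ.injective, Finset.card_image_of_injective _ σ.injective]

end Score

section Rule

variable {m k : ℕ} (F : ABCRankingRule m k)

theorem ABCRankingRule.rel_refl (A : Profile m) {W : Finset (Fin m)} (h : W.card = k) :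
    F.rel A W W :=
  (F.total A W W h h).elim id id

theorem ABCRankingRule.strictOf_iff (A : Profile m) {W₁ W₂ : Finset (Fin m)} (h₁ : W₁.card = k)
    (h₂ : W₂.card = k) : strictOf F.rel A W₁ W₂ ↔ ¬ F.rel A W₂ W₁ :=
  ⟨fun h => h.2, fun h => ⟨(F.total A W₁ W₂ h₁ h₂).resolve_right h, h⟩⟩

theorem Implements.rel_iff {F : ABCRankingRule m k} {f : ℕ → ℕ → ℝ} (hf : Implements m k f F)
    (A : Profile m) {W₁ W₂ : Finset (Fin m)} (h₁ : W₁.card = k) (h₂ : W₂.card = k) :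
    F.rel A W₁ W₂ ↔ score f W₂ A ≤ score f W₁ A := by
  rw [← not_lt, hf A W₂ W₁ h₂ h₁, ABCRankingRule.strict, F.strictOf_iff A h₂ h₁, not_not]

theorem IsCountingRule.symmetric_consistent_efficient_continuous {F : ABCRankingRule m k} (hF : IsCountingRule m k F) :
    (Anonymous m k F.rel ∧ Neutral m k F.rel) ∧ Consistent m k F.rel ∧
      WeakEfficient m k F.rel ∧ Continuous m k F.rel := by
  obtain ⟨f, hmono, hf⟩ := hF
  refine ⟨⟨?_, ?_⟩, ?_, ?_, ?_⟩
  · intro A A' h W₁ W₂ h₁ h₂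
    rw [hf.rel_iff _ h₁ h₂, hf.rel_iff _ h₁ h₂, score_perm f _ h, score_perm f _ h]
  · intro σ A W₁ W₂ h₁ h₂
    have hi (W : Finset (Fin m)) (h : W.card = k) : (W.image σ).card = k := by
      rw [Finset.card_image_of_injective _ σ.injective, h]
    rw [hf.rel_iff _ h₁ h₂, hf.rel_iff _ (hi _ h₁) (hi _ h₂), score_image, score_image]
  · intro A A' W₁ W₂ h₁ h₂
    rw [F.strictOf_iff _ h₁ h₂, F.strictOf_iff _ h₁ h₂]
    simp only [hf.rel_iff _ h₁ h₂, hf.rel_iff _ h₂ h₁, score_append]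
    constructor <;> intros <;> linarith
  · intro A W₁ W₂ h₁ h₂ h
    rw [hf.rel_iff _ h₁ h₂]
    refine List.sum_le_sum fun s hs => hmono _ _ _ (Finset.card_le_card fun c hc => ?_) ?_ ?_
    · rw [Finset.mem_inter] at hc ⊢
      exact ⟨hc.1, by_contra fun hc' => h s hs c hc.2 hc' hc.1⟩
    · exact h₁ ▸ Finset.card_le_card Finset.inter_subset_right
    · simpa using Finset.card_le_univ s
  · intro A A' W₁ W₂ h₁ h₂ h
    simp only [F.strictOf_iff _ h₁ h₂, hf.rel_iff _ h₂ h₁, score_append, score_nCopies,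
      not_le] at h ⊢
    obtain ⟨n, hn⟩ := exists_nat_gt ((score f W₂ A - score f W₁ A) /
      (score f W₁ A' - score f W₂ A'))
    refine ⟨n, ?_⟩
    rw [div_lt_iff₀ (by linarith)] at hn
    linarith

variable {F}

theorem rel_nCopies (hC : Consistent m k F.rel) {A : Profile m} {W₁ W₂ : Finset (Fin m)}
    (h₁ : W₁.card = k) (h₂ : W₂.card = k) (h₀ : F.rel [] W₁ W₂) (h : F.rel A W₁ W₂) (n : ℕ) :
    F.rel (nCopies n A) W₁ W₂ := by
  induction n with
  | zero => exact h₀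
  | succ n ih => exact nCopies_succ n A ▸ (hC _ _ _ _ h₁ h₂).2 h ih

end Rule

section Combinatorics

variable {m k : ℕ}

theorem exists_ballot_separating {W₁ W₂ : Finset (Fin m)} (h₁ : W₁.card = k) (h₂ : W₂.card = k)
    (hne : W₁ ≠ W₂) {p y : ℕ} (hp : 1 ≤ p) (hpk : p ≤ k) (hpy : p ≤ y) (hy : y + k + 1 ≤ m + p) :
    ∃ S : Finset (Fin m), S.card = y ∧ p ≤ (S ∩ W₁).card ∧ (S ∩ W₂).card < p := by
  have hI := Finset.card_sdiff_add_card_inter W₁ W₂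
  have hI' := Finset.card_sdiff_add_card_inter W₂ W₁
  rw [Finset.inter_comm] at hI'
  have hU := Finset.card_union_add_card_inter W₁ W₂
  have hO := Finset.card_add_card_compl (W₁ ∪ W₂)
  rw [Fintype.card_fin] at hO
  have hd : 0 < (W₁ \ W₂).card := by
    rw [Finset.card_pos, Finset.sdiff_nonempty]
    exact fun h => hne (Finset.eq_of_subset_of_card_le h (by omega))
  obtain ⟨l, i, j, r, hl, hi, hj, hr, hsum, hli, hri⟩ : ∃ l i j r : ℕ,
      l ≤ (W₁ \ W₂).card ∧ i ≤ (W₁ ∩ W₂).card ∧ j ≤ (W₁ ∪ W₂)ᶜ.card ∧ r ≤ (W₂ \ W₁).card ∧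
      l + i + j + r = y ∧ p ≤ l + i ∧ r + i < p := by
    obtain ⟨i, hi⟩ : ∃ i, i = min (p - 1) (W₁ ∩ W₂).card := ⟨_, rfl⟩
    obtain ⟨j, hj⟩ : ∃ j, j = min (y - p) (W₁ ∪ W₂)ᶜ.card := ⟨_, rfl⟩
    exact ⟨min (y - i - j) (W₁ \ W₂).card, i, j, y - i - j - (W₁ \ W₂).card, by omega, by omega,
      by omega, by omega, by omega, by omega, by omega⟩
  obtain ⟨L, hL, rfl⟩ := Finset.exists_subset_card_eq hl
  obtain ⟨I, hI, rfl⟩ := Finset.exists_subset_card_eq hi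
  obtain ⟨J, hJ, rfl⟩ := Finset.exists_subset_card_eq hj
  obtain ⟨R, hR, rfl⟩ := Finset.exists_subset_card_eq hr
  have hL' : ∀ x ∈ L, x ∈ W₁ ∧ x ∉ W₂ := fun x hx => by simpa using hL hx
  have hI' : ∀ x ∈ I, x ∈ W₁ ∧ x ∈ W₂ := fun x hx => by simpa using hI hx
  have hJ' : ∀ x ∈ J, x ∉ W₁ ∧ x ∉ W₂ := fun x hx => by simpa using hJ hx
  have hR' : ∀ x ∈ R, x ∈ W₂ ∧ x ∉ W₁ := fun x hx => by simpa using hR hx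
  have hS₁ : (L ∪ I ∪ J ∪ R) ∩ W₁ = L ∪ I := by ext x; grind
  have hS₂ : (L ∪ I ∪ J ∪ R) ∩ W₂ = R ∪ I := by ext x; grind
  have hLI : Disjoint L I := Finset.disjoint_left.2 (by grind)
  have hRI : Disjoint R I := Finset.disjoint_left.2 (by grind)
  have hLIJ : Disjoint (L ∪ I) J := Finset.disjoint_left.2 (by grind)
  have hLIJR : Disjoint (L ∪ I ∪ J) R := Finset.disjoint_left.2 (by grind)
  refine ⟨L ∪ I ∪ J ∪ R, ?_, ?_, ?_⟩
  · rw [Finset.card_union_of_disjoint hLIJR, Finset.card_union_of_disjoint hLIJ,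
      Finset.card_union_of_disjoint hLI, hsum]
  · rwa [hS₁, Finset.card_union_of_disjoint hLI]
  · rwa [hS₂, Finset.card_union_of_disjoint hRI]

theorem exists_perm_comp_eq {α κ : Type} [Fintype α] [DecidableEq κ] (c c' : α → κ)
    (h : ∀ i, Fintype.card {x // c x = i} = Fintype.card {x // c' x = i}) :
    ∃ σ : Equiv.Perm α, ∀ x, c' (σ x) = c x := by
  let e (i : κ) : {x // c x = i} ≃ {x // c' x = i} := Fintype.equivOfCardEq (h i)
  refine ⟨(Equiv.sigmaFiberEquiv c).symm.trans
    ((Equiv.sigmaCongrRight e).trans (Equiv.sigmaFiberEquiv c')), fun x => ?_⟩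
  exact (e (c x) ⟨x, rfl⟩).2

/-- Two triples (committee, adjacent committee, ballot) in which the ballot approves the candidate
only in the first committee and not the candidate only in the second one are related by a
permutation of the candidates if the obvious cardinalities agree. -/
theorem exists_perm_image_eq {W₁ W₂ S W₁' W₂' S' : Finset (Fin m)} (h₁ : W₁.card = k)
    (h₂ : W₂.card = k) (h₁' : W₁'.card = k) (h₂' : W₂'.card = k) (hd : (W₁ \ W₂).card = 1)
    (hd' : (W₁' \ W₂').card = 1) (ha : W₁ \ W₂ ⊆ S) (hb : Disjoint (W₂ \ W₁) S)
    (ha' : W₁' \ W₂' ⊆ S') (hb' : Disjoint (W₂' \ W₁') S')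
    (hp : (S ∩ W₁).card = (S' ∩ W₁').card) (hy : S.card = S'.card) :
    ∃ σ : Equiv.Perm (Fin m), W₁.image σ = W₁' ∧ W₂.image σ = W₂' ∧ S.image σ = S' := by
  let col (W₁ W₂ S : Finset (Fin m)) (x : Fin m) : Bool × Bool × Bool :=
    (decide (x ∈ W₁), decide (x ∈ W₂), decide (x ∈ S))
  have count : ∀ W₁ W₂ S : Finset (Fin m), W₁.card = k → W₂.card = k → (W₁ \ W₂).card = 1 →
      W₁ \ W₂ ⊆ S → Disjoint (W₂ \ W₁) S → ∀ i, ((Fintype.card {x // col W₁ W₂ S x = i} : ℕ) : ℤ) =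
        match i with
        | (true, true, true) => ((S ∩ W₁).card : ℤ) - 1
        | (true, true, false) => (k : ℤ) - (S ∩ W₁).card
        | (true, false, true) => 1
        | (true, false, false) => 0
        | (false, true, true) => 0
        | (false, true, false) => 1
        | (false, false, true) => (S.card : ℤ) - (S ∩ W₁).card
        | (false, false, false) => (m : ℤ) - k - 1 - S.card + (S ∩ W₁).card := by
    intro W₁ W₂ S h₁ h₂ hd ha hb i
    have hb'' : ∀ x, x ∈ W₂ → x ∉ W₁ → x ∉ S := fun x hx hx' =>
      Finset.disjoint_left.1 hb (Finset.mem_sdiff.2 ⟨hx, hx'⟩)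
    have ha'' : ∀ x, x ∈ W₁ → x ∉ W₂ → x ∈ S := fun x hx hx' =>
      ha (Finset.mem_sdiff.2 ⟨hx, hx'⟩)
    have hI := Finset.card_sdiff_add_card_inter W₁ W₂
    have hI' := Finset.card_sdiff_add_card_inter W₂ W₁
    rw [Finset.inter_comm] at hI'
    have e1 := Finset.card_sdiff_add_card_inter S W₁
    have e2 : (S ∩ W₁).card = ((S ∩ W₁) ∩ W₂).card + (W₁ \ W₂).card := by
      rw [← Finset.card_sdiff_add_card_inter (S ∩ W₁) W₂, add_comm]
      congr 2
      ext x
      grind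
    have e3 : ((W₁ ∩ W₂) \ S).card + ((S ∩ W₁) ∩ W₂).card = (W₁ ∩ W₂).card := by
      rw [← Finset.card_sdiff_add_card_inter (W₁ ∩ W₂) S]
      congr 2
      ext x
      grind
    have e4 := Finset.card_add_card_compl ((W₁ ∪ W₂) ∪ S)
    rw [Fintype.card_fin] at e4
    have e5 : ((W₁ ∪ W₂) ∪ S).card = (S \ W₁).card + (W₁ ∪ W₂).card := by
      have hdis : Disjoint (S \ W₁) (W₁ ∪ W₂) := Finset.disjoint_left.2 fun x hx hx' => by
        rw [Finset.mem_sdiff] at hx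
        exact hb'' x ((Finset.mem_union.1 hx').resolve_left hx.2) hx.2 hx.1
      rw [← Finset.card_union_of_disjoint hdis]
      congr 1
      ext x
      simp only [Finset.mem_union, Finset.mem_sdiff]
      tauto
    have hU := Finset.card_union_add_card_inter W₁ W₂
    have key : ∀ T : Finset (Fin m), (∀ x, col W₁ W₂ S x = i ↔ x ∈ T) →
        Fintype.card {x // col W₁ W₂ S x = i} = T.card := by
      intro T hT
      rw [Fintype.card_of_subtype T fun x => (hT x).symm]
    rcases i with ⟨_ | _, _ | _, _ | _⟩
    · rw [key ((W₁ ∪ W₂) ∪ S)ᶜ (by intro x; simp [col])]; dsimp only; omega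
    · rw [key (S \ W₁) (by intro x; simp [col]; grind)]; dsimp only; omega
    · rw [key (W₂ \ W₁) (by intro x; simp [col]; grind)]; dsimp only; omega
    · rw [key ∅ (by intro x; simp [col]; grind)]; simp
    · rw [key ∅ (by intro x; simp [col]; grind)]; simp
    · rw [key (W₁ \ W₂) (by intro x; simp [col]; grind)]; dsimp only; omega
    · rw [key ((W₁ ∩ W₂) \ S) (by intro x; simp [col]; grind)]; dsimp only; omega
    · rw [key ((S ∩ W₁) ∩ W₂) (by intro x; simp [col]; grind)]; dsimp only; omega
  obtain ⟨σ, hσ⟩ := exists_perm_comp_eq (col W₁ W₂ S) (col W₁' W₂' S') fun i => by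
    have e := count W₁ W₂ S h₁ h₂ hd ha hb i
    have e' := count W₁' W₂' S' h₁' h₂' hd' ha' hb' i
    rw [hp, hy] at e
    exact_mod_cast e.trans e'.symm
  have image_eq : ∀ T T' : Finset (Fin m), (∀ x, σ x ∈ T' ↔ x ∈ T) → T.image σ = T' := by
    intro T T' h
    ext x
    rw [Finset.mem_image]
    exact ⟨fun ⟨z, hz, hzx⟩ => hzx ▸ (h z).2 hz,
      fun hx => ⟨σ.symm x, (h _).1 (by simpa using hx), by simp⟩⟩
  simp only [col, Prod.mk.injEq, decide_eq_decide] at hσ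
  exact ⟨σ, image_eq _ _ fun x => (hσ x).1, image_eq _ _ fun x => (hσ x).2.1,
    image_eq _ _ fun x => (hσ x).2.2⟩

theorem exists_involutive_image_eq {W₁ W₂ : Finset (Fin m)} (h : W₁.card = W₂.card) :
    ∃ τ : Equiv.Perm (Fin m), Function.Involutive τ ∧ W₁.image τ = W₂ ∧ W₂.image τ = W₁ := by
  have hc : (W₁ \ W₂).card = (W₂ \ W₁).card := Finset.card_sdiff_comm h
  let e := Finset.equivOfCardEq hc
  let g (x : Fin m) : Fin m :=
    if h : x ∈ W₁ \ W₂ then e ⟨x, h⟩ else if h : x ∈ W₂ \ W₁ then e.symm ⟨x, h⟩ else x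
  have g₁ (x : Fin m) (h : x ∈ W₁ \ W₂) : g x = e ⟨x, h⟩ := dif_pos h
  have g₂ (x : Fin m) (h : x ∈ W₂ \ W₁) : g x = e.symm ⟨x, h⟩ := by
    have : x ∉ W₁ \ W₂ := by grind
    simp only [g, dif_neg this, dif_pos h]
  have g₃ (x : Fin m) (h : x ∉ W₁ \ W₂) (h' : x ∉ W₂ \ W₁) : g x = x := by
    simp only [g, dif_neg h, dif_neg h']
  have hg : Function.Involutive g := by
    intro x
    by_cases h : x ∈ W₁ \ W₂
    · rw [g₁ x h, g₂ _ (e ⟨x, h⟩).2]; simp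
    · by_cases h' : x ∈ W₂ \ W₁
      · rw [g₂ x h', g₁ _ (e.symm ⟨x, h'⟩).2]; simp
      · rw [g₃ x h h', g₃ x h h']
  have m₁ : ∀ x ∈ W₁, g x ∈ W₂ := by
    intro x hx
    by_cases h : x ∈ W₂
    · rwa [g₃ x (by simp [h]) (by simp [hx])]
    · rw [g₁ x (by simp [h, hx])]
      exact (Finset.mem_sdiff.1 (e _).2).1
  have m₂ : ∀ x ∈ W₂, g x ∈ W₁ := by
    intro x hx
    by_cases h : x ∈ W₁
    · rwa [g₃ x (by simp [hx]) (by simp [h])]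
    · rw [g₂ x (by simp [h, hx])]
      exact (Finset.mem_sdiff.1 (e.symm _).2).1
  refine ⟨hg.toPerm, hg, ?_, ?_⟩
  · ext x
    rw [Finset.mem_image]
    exact ⟨fun ⟨z, hz, hzx⟩ => hzx ▸ m₁ z hz, fun hx => ⟨g x, m₂ x hx, hg x⟩⟩
  · ext x
    rw [Finset.mem_image]
    exact ⟨fun ⟨z, hz, hzx⟩ => hzx ▸ m₂ z hz, fun hx => ⟨g x, m₁ x hx, hg x⟩⟩

theorem mem_image_of_involutive {τ : Equiv.Perm (Fin m)} (hτ : Function.Involutive τ)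
    (S : Finset (Fin m)) (x : Fin m) : x ∈ S.image τ ↔ τ x ∈ S := by
  rw [Finset.mem_image]
  exact ⟨fun ⟨z, hz, hzx⟩ => hzx ▸ (hτ z).symm ▸ hz, fun h => ⟨τ x, h, hτ x⟩⟩

end Combinatorics

section Adjacent

variable {m k : ℕ} {F : ABCRankingRule m k}

/-- The comparison between two committees is given by the sign of a sum of ballot weights. -/
def IsWeight (F : ABCRankingRule m k) (W₁ W₂ : Finset (Fin m)) (v : Finset (Fin m) → ℝ) : Prop :=
  ∀ A : Profile m, (F.rel A W₁ W₂ ↔ 0 ≤ (A.map v).sum) ∧ (F.rel A W₂ W₁ ↔ (A.map v).sum ≤ 0)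

theorem coe_nCopies (n : ℕ) (A : Profile m) :
    (nCopies n A : Multiset (Finset (Fin m))) = n • (A : Multiset (Finset (Fin m))) := by
  induction n with
  | zero => simp
  | succ n ih => rw [nCopies_succ, ← Multiset.coe_add, ih, succ_nsmul']

theorem exists_weight_of_involutive_image_eq (hA : Anonymous m k F.rel) (hN : Neutral m k F.rel)
    (hC : Consistent m k F.rel) (hCt : Continuous m k F.rel) {W₁ W₂ : Finset (Fin m)}
    (h₁ : W₁.card = k) (h₂ : W₂.card = k) {τ : Equiv.Perm (Fin m)} (hτ : Function.Involutive τ)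
    (hτ₁ : W₁.image τ = W₂) :
    ∃ v : Finset (Fin m) → ℝ, (∀ S, v (S.image τ) = -v S) ∧ IsWeight F W₁ W₂ v := by
  have hττ (S : Finset (Fin m)) : (S.image τ).image τ = S := by
    rw [Finset.image_image, hτ.comp_self, Finset.image_id]
  have hτ₂ : W₂.image τ = W₁ := by rw [← hτ₁, hττ]
  have coe (s : Multiset (Finset (Fin m))) (A : Profile m) (h : s = A) {V W : Finset (Fin m)}
      (hV : V.card = k) (hW : W.card = k) : F.rel s.toList V W ↔ F.rel A V W :=
    hA _ _ (Multiset.coe_eq_coe.1 (by rw [Multiset.coe_toList, h])) V W hV hW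
  have hR (s : Multiset (Finset (Fin m))) :
      F.rel (s.map fun S => S.image τ).toList W₁ W₂ ↔ F.rel s.toList W₂ W₁ := by
    rw [hN τ s.toList W₂ W₁ h₂ h₁, hτ₁, hτ₂]
    exact coe _ _ (by rw [← Multiset.map_coe, Multiset.coe_toList]) h₁ h₂
  have coe_add (s t : Multiset (Finset (Fin m))) :
      s + t = (s.toList ++ t.toList : Profile m) := by
    rw [← Multiset.coe_add, Multiset.coe_toList, Multiset.coe_toList]
  obtain ⟨v, hv, hv'⟩ := exists_weight_of_nonneg (fun s => F.rel s.toList W₁ W₂)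
    (fun S : Finset (Fin m) => S.image τ) hττ
    (fun s => by rw [hR]; exact F.total _ _ _ h₁ h₂)
    (fun s t hs ht => (coe _ _ (coe_add s t) h₁ h₂).2 ((hC _ _ _ _ h₁ h₂).2 hs ht))
    (fun s t hs ht => by
      rw [hR, ← F.strictOf_iff _ h₁ h₂] at hs
      rw [hR, coe _ _ (coe_add s t) h₂ h₁]
      exact ((hC _ _ _ _ h₁ h₂).1 hs ht).2)
    (fun s t hs => by
      rw [hR, ← F.strictOf_iff _ h₁ h₂] at hs
      obtain ⟨n, hn⟩ := hCt t.toList _ _ _ h₁ h₂ hs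
      refine ⟨n, ?_⟩
      rw [hR, coe _ (t.toList ++ nCopies n s.toList) _ h₂ h₁]
      · exact hn.2
      · rw [← Multiset.coe_add, coe_nCopies, Multiset.coe_toList, Multiset.coe_toList])
  refine ⟨v, hv, fun A => ⟨?_, ?_⟩⟩
  · rw [← coe A A rfl h₁ h₂, hv']
    simp
  · rw [← coe A A rfl h₂ h₁, ← hR, hv', Multiset.map_map]
    simp only [Function.comp_def, hv]
    rw [Multiset.sum_map_neg, neg_nonneg, Multiset.map_coe, Multiset.sum_coe]

theorem IsWeight.image_eq {W₁ W₂ : Finset (Fin m)} {v : Finset (Fin m) → ℝ}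
    (h : IsWeight F W₁ W₂ v) (hN : Neutral m k F.rel) (h₁ : W₁.card = k) (h₂ : W₂.card = k)
    {τ : Equiv.Perm (Fin m)} (hv : ∀ S, v (S.image τ) = -v S) {σ : Equiv.Perm (Fin m)}
    (hσ₁ : W₁.image σ = W₁) (hσ₂ : W₂.image σ = W₂) (S : Finset (Fin m)) :
    v (S.image σ) = v S := by
  have key (σ : Equiv.Perm (Fin m)) (hσ₁ : W₁.image σ = W₁) (hσ₂ : W₂.image σ = W₂)
      (S : Finset (Fin m)) : v (S.image σ) ≤ v S := by
    have hsign (A : Profile m) : (0 ≤ (A.map v).sum ↔ 0 ≤ (A.map fun S => v (S.image σ)).sum) ∧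
        ((A.map v).sum ≤ 0 ↔ (A.map fun S => v (S.image σ)).sum ≤ 0) := by
      have e := hN σ A W₁ W₂ h₁ h₂
      have e' := hN σ A W₂ W₁ h₂ h₁
      rw [hσ₁, hσ₂, (h _).1, (h _).1, List.map_map] at e
      rw [hσ₁, hσ₂, (h _).2, (h _).2, List.map_map] at e'
      exact ⟨e, e'⟩
    have hneg (S : Finset (Fin m)) : v ((S.image τ).image σ) = -v (S.image σ) := by
      have e := (hsign [S, S.image τ]).1
      have e' := (hsign [S, S.image τ]).2
      simp only [List.map_cons, List.map_nil, List.sum_cons, List.sum_nil, hv] at e e'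
      have := e.1 (by simp)
      have := e'.1 (by simp)
      linarith
    have hlt (S T : Finset (Fin m)) (hST : v S < v T) : v (S.image σ) < v (T.image σ) := by
      have e := (hsign [S, T.image τ]).1
      simp only [List.map_cons, List.map_nil, List.sum_cons, List.sum_nil, hv, hneg] at e
      by_contra hcon
      have := e.2 (by linarith)
      linarith
    by_contra! hcon
    have hpow (n : ℕ) : v S < v (S.image (σ ^ (n + 1) : Equiv.Perm (Fin m))) := by
      induction n with
      | zero => simpa using hcon
      | succ n ih =>
        have := hcon.trans (hlt _ _ ih)
        rwa [Finset.image_image, ← Equiv.Perm.coe_mul, ← pow_succ'] at this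
    have := hpow (orderOf σ - 1)
    rw [Nat.sub_add_cancel (orderOf_pos σ), pow_orderOf_eq_one] at this
    simp at this
  have hinv (W : Finset (Fin m)) : (W.image σ).image (σ⁻¹ : Equiv.Perm (Fin m)) = W := by
    rw [Finset.image_image, ← Equiv.Perm.coe_mul, inv_mul_cancel, Equiv.Perm.coe_one,
      Finset.image_id]
  refine le_antisymm (key σ hσ₁ hσ₂ S) ?_
  have := key σ⁻¹ (by rw [← hσ₁, hinv, hσ₁]) (by rw [← hσ₂, hinv, hσ₂]) (S.image σ)
  rwa [hinv] at this

/-- The marginal weight of the `p`-th approved committee member on a ballot of size `y`, read off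
from a ballot approving `a` but not `b`; zero if there is no such ballot. -/
noncomputable def marginalWeight (v : Finset (Fin m) → ℝ) (W : Finset (Fin m)) (a b : Fin m)
    (p y : ℕ) : ℝ :=
  open Classical in
  if h : ∃ S : Finset (Fin m), (a ∈ S ∧ b ∉ S) ∧ (S ∩ W).card = p ∧ S.card = y then v h.choose
  else 0

theorem exists_adjacent_counting_function (hk : 0 < k) (hkm : k < m) (hA : Anonymous m k F.rel)
    (hN : Neutral m k F.rel) (hC : Consistent m k F.rel) (hW : WeakEfficient m k F.rel)
    (hCt : Continuous m k F.rel) :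
    ∃ f : ℕ → ℕ → ℝ, (∀ x x' y, x' ≤ x → f x' y ≤ f x y) ∧
      (∀ (W₁ W₂ : Finset (Fin m)), W₁.card = k → W₂.card = k → (W₁ \ W₂).card = 1 →
        ∀ A, F.rel A W₁ W₂ ↔ score f W₂ A ≤ score f W₁ A) ∧
      ((∀ x y, f x y = 0) ∨
        ∃ p y, 1 ≤ p ∧ p ≤ k ∧ p ≤ y ∧ y + k + 1 ≤ m + p ∧ f (p - 1) y < f p y) := by
  obtain ⟨W₁, h₁⟩ : ∃ W : Finset (Fin m), W.card = k := by
    obtain ⟨W, -, hW⟩ := Finset.exists_subset_card_eq (s := (Finset.univ : Finset (Fin m))) (n := k)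
      (by simpa using hkm.le)
    exact ⟨W, hW⟩
  obtain ⟨a, ha⟩ : W₁.Nonempty := Finset.card_pos.1 (by omega)
  obtain ⟨b, hb⟩ : ∃ b, b ∉ W₁ := by
    by_contra! h
    have := Finset.card_le_card (fun x _ => h x : (Finset.univ : Finset (Fin m)) ⊆ W₁)
    simp at this
    omega
  have hab : a ≠ b := fun h => hb (h ▸ ha)
  let τ : Equiv.Perm (Fin m) := Equiv.swap a b
  have hτ : Function.Involutive τ := Equiv.swap_apply_self a b
  have mem_image := mem_image_of_involutive hτ
  obtain ⟨W₂, hτ₁⟩ : ∃ W₂, W₁.image τ = W₂ := ⟨_, rfl⟩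
  have h₂ : W₂.card = k := by rw [← hτ₁, Finset.card_image_of_injective _ τ.injective, h₁]
  have ha₂ : a ∉ W₂ := by rw [← hτ₁, mem_image]; simpa [τ] using hb
  have hb₂ : b ∈ W₂ := by rw [← hτ₁, mem_image]; simpa [τ] using ha
  have hx (x : Fin m) (hxa : x ≠ a) (hxb : x ≠ b) : x ∈ W₂ ↔ x ∈ W₁ := by
    rw [← hτ₁, mem_image, Equiv.swap_apply_of_ne_of_ne hxa hxb]
  have hd₁ : W₁ \ W₂ = {a} := by ext x; grind
  have hd₂ : W₂ \ W₁ = {b} := by ext x; grind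
  obtain ⟨v, hv, hwt⟩ := exists_weight_of_involutive_image_eq hA hN hC hCt h₁ h₂ hτ hτ₁
  have hcongr (S S' : Finset (Fin m)) (hS : a ∈ S ∧ b ∉ S) (hS' : a ∈ S' ∧ b ∉ S')
      (hp : (S ∩ W₁).card = (S' ∩ W₁).card) (hy : S.card = S'.card) : v S = v S' := by
    obtain ⟨σ, hσ₁, hσ₂, rfl⟩ := exists_perm_image_eq h₁ h₂ h₁ h₂ (by simp [hd₁]) (by simp [hd₁])
      (by simpa [hd₁] using hS.1) (by simpa [hd₂] using hS.2) (by simpa [hd₁] using hS'.1)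
      (by simpa [hd₂] using hS'.2) hp hy
    exact (hwt.image_eq hN h₁ h₂ hv hσ₁ hσ₂ S).symm
  have hnonneg (S : Finset (Fin m)) (hS : b ∉ S) : 0 ≤ v S := by
    have := (hwt [S]).1.1 (hW _ _ _ h₁ h₂ fun s hs c hc₂ hc₁ => by
      have : c ∈ W₂ \ W₁ := Finset.mem_sdiff.2 ⟨hc₂, hc₁⟩
      rw [hd₂, Finset.mem_singleton] at this
      rw [List.mem_singleton] at hs
      rwa [hs, this])
    simpa using this
  have hzero (S : Finset (Fin m)) (hS : a ∈ S ↔ b ∈ S) : S.image τ = S := by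
    ext x
    rw [mem_image]
    by_cases hxa : x = a
    · simp [τ, hxa, hS]
    by_cases hxb : x = b
    · simp [τ, hxb, hS]
    rw [Equiv.swap_apply_of_ne_of_ne hxa hxb]
  let D := marginalWeight v W₁ a b
  have hD (S : Finset (Fin m)) (hS : a ∈ S ∧ b ∉ S) : v S = D (S ∩ W₁).card S.card := by
    have h : ∃ T : Finset (Fin m), (a ∈ T ∧ b ∉ T) ∧ (T ∩ W₁).card = (S ∩ W₁).card ∧
        T.card = S.card := ⟨S, hS, rfl, rfl⟩
    simp only [D, marginalWeight, dif_pos h]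
    exact hcongr _ _ hS h.choose_spec.1 h.choose_spec.2.1.symm h.choose_spec.2.2.symm
  have hD₀ (p y : ℕ) : 0 ≤ D p y := by
    simp only [D, marginalWeight]
    split_ifs with h
    · exact hnonneg _ h.choose_spec.1.2
    · exact le_rfl
  let f (x y : ℕ) : ℝ := ∑ i ∈ Finset.range x, D (i + 1) y
  have hvf (S : Finset (Fin m)) : v S = f (S ∩ W₁).card S.card - f (S ∩ W₂).card S.card := by
    have hone (S : Finset (Fin m)) (hS : a ∈ S ∧ b ∉ S) :
        v S = f (S ∩ W₁).card S.card - f (S ∩ W₂).card S.card := by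
      have : S ∩ W₁ = insert a (S ∩ W₂) := by ext x; grind
      rw [hD S hS, this, Finset.card_insert_of_notMem (by simp [ha₂])]
      simp only [f, Finset.sum_range_succ]
      ring
    have hcard (S T : Finset (Fin m)) : (S.image τ ∩ T.image τ).card = (S ∩ T).card := by
      rw [← Finset.image_inter _ _ τ.injective, Finset.card_image_of_injective _ τ.injective]
    have hτ₂ : W₂.image τ = W₁ := by
      rw [← hτ₁, Finset.image_image, hτ.comp_self, Finset.image_id]
    by_cases hS : a ∈ S ↔ b ∈ S
    · have e := hv S
      have e' := hcard S W₁
      rw [hzero S hS] at e e'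
      rw [hτ₁] at e'
      rw [e']
      linarith
    · by_cases hSa : a ∈ S
      · exact hone S ⟨hSa, fun h => hS (by simp [hSa, h])⟩
      · have hSb : b ∈ S := by tauto
        have := hone (S.image τ) (by simpa [mem_image, τ] using ⟨hSb, hSa⟩)
        rw [hv, ← hτ₁, hcard, Finset.card_image_of_injective _ τ.injective] at this
        have e := hcard S W₂
        rw [hτ₂] at e
        rw [e] at this
        linarith
  have hsum (A : Profile m) : (A.map v).sum = score f W₁ A - score f W₂ A := by
    induction A with
    | nil => simp
    | cons S A ih =>
      rw [List.map_cons, List.sum_cons, ih, score_cons, score_cons, hvf]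
      ring
  refine ⟨f, ?_, ?_, ?_⟩
  · intro x x' y hx
    exact Finset.sum_le_sum_of_subset_of_nonneg (Finset.range_mono hx) fun i _ _ => hD₀ _ _
  · intro V₁ V₂ hV₁ hV₂ hd A
    have hd' : (V₂ \ V₁).card = 1 := by rw [Finset.card_sdiff_comm (hV₂.trans hV₁.symm), hd]
    obtain ⟨σ, hσ₁, hσ₂, -⟩ := exists_perm_image_eq (S := V₁) (S' := W₁) hV₁ hV₂ h₁ h₂ hd
      (by simp [hd₁]) Finset.sdiff_subset Finset.sdiff_disjoint Finset.sdiff_subset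
      Finset.sdiff_disjoint (by simp [hV₁, h₁]) (by simp [hV₁, h₁])
    rw [hN σ A V₁ V₂ hV₁ hV₂, hσ₁, hσ₂, (hwt _).1, hsum, ← hσ₁, ← hσ₂, score_image, score_image,
      sub_nonneg]
  · by_cases h : ∀ p y, D (p + 1) y = 0
    · exact .inl fun x y => Finset.sum_eq_zero fun i _ => h i y
    · push Not at h
      obtain ⟨p, y, hpy⟩ := h
      refine .inr ⟨p + 1, y, by omega, ?_⟩
      have hlt : f (p + 1 - 1) y < f (p + 1) y := by
        have := (hD₀ (p + 1) y).lt_of_ne' hpy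
        simp only [f, add_tsub_cancel_right, Finset.sum_range_succ]
        linarith
      simp only [D, marginalWeight] at hpy
      split_ifs at hpy with h
      · obtain ⟨S, ⟨-, hSb⟩, hp, hy⟩ := h
        have e₁ : (S ∩ W₁).card ≤ W₁.card := Finset.card_le_card Finset.inter_subset_right
        have e₂ : (S ∩ W₁).card ≤ S.card := Finset.card_le_card Finset.inter_subset_left
        have e₃ := Finset.card_union_add_card_inter S W₁
        have e₄ : (insert b (S ∪ W₁)).card ≤ m := by
          simpa using Finset.card_le_univ (insert b (S ∪ W₁))
        rw [Finset.card_insert_of_notMem (by simp [hSb, hb])] at e₄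
        exact ⟨by omega, by omega, by omega, hlt⟩
      · exact absurd rfl hpy

end Adjacent

theorem exists_nat_mul_add_mem_Ioo {h h' z : ℝ} (hh : 0 < h) (hz : z ≠ 0)
    (hzh : 0 ≤ z * (h / 2 - h')) :
    ∃ n n' : ℕ, 0 < n * h' + n' * z ∧ n * h' + n' * z < n * h := by
  have hz' : 0 < |z| := abs_pos.2 hz
  have hx : 0 ≤ (h / 2 - h') / z := by
    have : (h / 2 - h') / z = z * (h / 2 - h') / (z * z) := by field_simp
    rw [this]
    exact div_nonneg hzh (mul_self_nonneg z)
  obtain ⟨q, hq, hq'⟩ := exists_rat_btwn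
    (show (h / 2 - h') / z < (h / 2 - h') / z + h / (2 * |z|) by
      have : 0 < h / (2 * |z|) := by positivity
      linarith)
  have hbound : |(q - (h / 2 - h') / z) * z| < h / 2 := by
    rw [abs_mul, abs_of_pos (by linarith)]
    calc _ < h / (2 * |z|) * |z| := by gcongr; linarith
      _ = h / 2 := by field_simp
  have hqz : (q - (h / 2 - h') / z) * z = q * z + h' - h / 2 := by field_simp; ring
  rw [hqz, abs_lt] at hbound
  have hq₀ : 0 ≤ q := by exact_mod_cast hx.trans hq.le
  have hden : (0 : ℝ) < q.den := by exact_mod_cast q.pos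
  have hnum : ((q.num.toNat : ℕ) : ℝ) = q * q.den := by
    have h₁ : ((q.num.toNat : ℕ) : ℤ) = q.num := Int.toNat_of_nonneg (Rat.num_nonneg.2 hq₀)
    have h₂ : ((q.num.toNat : ℕ) : ℚ) = q * q.den := by
      rw [Rat.mul_den_eq_num]
      exact_mod_cast h₁
    exact_mod_cast h₂
  refine ⟨q.den, q.num.toNat, ?_, ?_⟩ <;> rw [hnum] <;> nlinarith

section Extension

variable {m k : ℕ} {F : ABCRankingRule m k}

theorem card_exchange {W₁ W₂ : Finset (Fin m)} {b c : Fin m} (hb : b ∈ W₁ ∧ b ∉ W₂)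
    (hc : c ∈ W₂ ∧ c ∉ W₁) :
    (insert c (W₁.erase b)).card = W₁.card ∧ (W₁ \ insert c (W₁.erase b)).card = 1 ∧
      (insert c (W₁.erase b) \ W₂).card = (W₁ \ W₂).card - 1 := by
  have e₁ : W₁ \ insert c (W₁.erase b) = {b} := by ext x; grind
  have e₂ : insert c (W₁.erase b) \ W₂ = (W₁ \ W₂).erase b := by ext x; grind
  refine ⟨?_, ?_, ?_⟩
  · rw [Finset.card_insert_of_notMem (by simp [hc.2]), Finset.card_erase_add_one hb.1]
  · rw [e₁, Finset.card_singleton]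
  · rw [e₂, Finset.card_erase_of_mem (Finset.mem_sdiff.2 hb)]

theorem map_image_powersetCard_perm (σ : Equiv.Perm (Fin m)) (y : ℕ) :
    (((Finset.univ : Finset (Fin m)).powersetCard y).toList.map fun S => S.image σ).Perm
      ((Finset.univ : Finset (Fin m)).powersetCard y).toList := by
  have hinj : Function.Injective fun S : Finset (Fin m) => S.image σ :=
    Finset.image_injective σ.injective
  rw [List.perm_ext_iff_of_nodup ((Finset.nodup_toList _).map hinj) (Finset.nodup_toList _)]
  intro S
  simp only [List.mem_map, Finset.mem_toList, Finset.mem_powersetCard_univ]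
  constructor
  · rintro ⟨T, rfl, rfl⟩
    exact Finset.card_image_of_injective _ σ.injective
  · rintro rfl
    refine ⟨S.image σ.symm, Finset.card_image_of_injective _ σ.symm.injective, ?_⟩
    simp [Finset.image_image]

theorem score_powersetCard (f : ℕ → ℕ → ℝ) (y : ℕ) {V W : Finset (Fin m)} (h : V.card = W.card) :
    score f V ((Finset.univ : Finset (Fin m)).powersetCard y).toList =
      score f W ((Finset.univ : Finset (Fin m)).powersetCard y).toList := by
  obtain ⟨σ, -, rfl, -⟩ := exists_involutive_image_eq h
  rw [← score_perm f (V.image σ) (map_image_powersetCard_perm σ y), score_image]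

theorem score_erase (f : ℕ → ℕ → ℝ) (W : Finset (Fin m)) {A : Profile m} {S : Finset (Fin m)}
    (h : S ∈ A) : score f W (A.erase S) = score f W A - score f W [S] := by
  rw [score_perm f W (List.perm_cons_erase h)]
  simp

/-- If some ballot gives the pair `W₁`, `τ W₁` and the pair `W`, `τ W` different total scores, then
there are `τ`-symmetric profiles in which the score difference of `W₁` and `W` is nonzero and has
a prescribed sign. -/
theorem exists_symmetric_profile (f : ℕ → ℕ → ℝ) {W₁ W : Finset (Fin m)} (h : W₁.card = W.card)
    {τ : Equiv.Perm (Fin m)} (hτ : Function.Involutive τ) {S : Finset (Fin m)}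
    (hS : score f W₁ [S] + score f (W₁.image τ) [S] ≠ score f W [S] + score f (W.image τ) [S])
    (t : ℝ) : ∃ B : Profile m, (B.map fun S => S.image τ).Perm B ∧
      score f W₁ B - score f W B ≠ 0 ∧ 0 ≤ (score f W₁ B - score f W B) * t := by
  have hττ (S : Finset (Fin m)) : (S.image τ).image τ = S := by
    rw [Finset.image_image, hτ.comp_self, Finset.image_id]
  have mirror (V : Finset (Fin m)) : score f (V.image τ) [S] = score f V [S.image τ] := by
    rw [← score_image f τ V [S.image τ], List.map_singleton, hττ]
  rw [mirror, mirror] at hS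
  let L := ((Finset.univ : Finset (Fin m)).powersetCard S.card).toList
  have hL : (L.map fun S => S.image τ).Perm L := map_image_powersetCard_perm τ S.card
  have hLS : S ∈ L := by simp [L]
  have hLτ : S.image τ ∈ L := by simp [L, Finset.card_image_of_injective _ τ.injective]
  have hLs : score f W₁ L = score f W L := score_powersetCard f _ h
  have hinj : Function.Injective fun S : Finset (Fin m) => S.image τ :=
    Finset.image_injective τ.injective
  have e (V : Finset (Fin m)) :
      score f V [S, S.image τ] = score f V [S] + score f V [S.image τ] := score_append f V [S] _
  have e' (V : Finset (Fin m)) : score f V (L.erase S ++ L.erase (S.image τ)) =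
      2 * score f V L - (score f V [S] + score f V [S.image τ]) := by
    rw [score_append, score_erase f V hLS, score_erase f V hLτ]
    ring
  have hB₁ : (([S, S.image τ] : Profile m).map fun S => S.image τ).Perm [S, S.image τ] := by
    simp only [List.map_cons, List.map_nil, hττ]
    exact List.Perm.swap _ _ _
  have hB₂ : ((L.erase S ++ L.erase (S.image τ)).map fun S => S.image τ).Perm
      (L.erase S ++ L.erase (S.image τ)) := by
    rw [List.map_append, List.map_erase hinj, List.map_erase hinj, hττ]
    exact ((hL.erase _).append (hL.erase _)).trans List.perm_append_comm
  rcases le_total 0 ((score f W₁ [S, S.image τ] - score f W [S, S.image τ]) * t) with ht | ht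
  · refine ⟨_, hB₁, ?_, ht⟩
    rw [e, e]
    exact sub_ne_zero.2 hS
  · refine ⟨_, hB₂, ?_, ?_⟩
    · rw [e', e', hLs]
      intro h0
      exact hS (by linarith)
    · rw [e', e', hLs]
      rw [e, e] at ht
      linarith

theorem strict_of_symmetric_path (hA : Anonymous m k F.rel) (hN : Neutral m k F.rel)
    (hC : Consistent m k F.rel) (hW : WeakEfficient m k F.rel) {f : ℕ → ℕ → ℝ}
    {W₁ W₂ W : Finset (Fin m)} (h₁ : W₁.card = k) (h₂ : W₂.card = k) (h : W.card = k)
    {τ : Equiv.Perm (Fin m)} (hτ : Function.Involutive τ) (hτ₁ : W₁.image τ = W₂)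
    {S : Finset (Fin m)}
    (hS : score f W₁ [S] + score f W₂ [S] ≠ score f W [S] + score f (W.image τ) [S])
    (hstrict₁ : ∀ A, score f W A < score f W₁ A → strictOf F.rel A W₁ W)
    (hstrict₂ : ∀ A, score f W₂ A < score f W A → strictOf F.rel A W W₂)
    {A : Profile m} (hlt : score f W₂ A < score f W₁ A) : strictOf F.rel A W₁ W₂ := by
  have hτ₂ : W₂.image τ = W₁ := by
    rw [← hτ₁, Finset.image_image, hτ.comp_self, Finset.image_id]
  obtain ⟨B, hB, hz, ht⟩ := exists_symmetric_profile f (h₁.trans h.symm) hτ (hτ₁ ▸ hS)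
    ((score f W₁ A - score f W₂ A) / 2 - (score f W₁ A - score f W A))
  obtain ⟨n, n', hpos, hlt'⟩ := exists_nat_mul_add_mem_Ioo (sub_pos.2 hlt) hz ht
  have hBtie : F.rel B W₁ W₂ ↔ F.rel B W₂ W₁ := by
    rw [hN τ B W₁ W₂ h₁ h₂, hτ₁, hτ₂]
    exact hA _ _ hB _ _ h₂ h₁
  have hBrel : F.rel B W₂ W₁ := (F.total B W₁ W₂ h₁ h₂).elim hBtie.1 id
  have hBscore : score f W₁ B = score f W₂ B := by
    rw [← score_image f τ W₁ B, hτ₁, score_perm f W₂ hB]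
  rw [F.strictOf_iff A h₁ h₂]
  intro hrel
  have hnil : F.rel [] W₂ W₁ := hW _ _ _ h₂ h₁ (by simp)
  have hP := (hC _ _ _ _ h₂ h₁).2 (rel_nCopies hC h₂ h₁ hnil hrel n)
    (rel_nCopies hC h₂ h₁ hnil hBrel n')
  have hP₁ := hstrict₁ (nCopies n A ++ nCopies n' B) (by
    simp only [score_append, score_nCopies]
    linarith)
  have hP₂ := hstrict₂ (nCopies n A ++ nCopies n' B) (by
    simp only [score_append, score_nCopies, ← hBscore]
    linarith)
  exact hP₂.2 (F.trans _ _ _ _ h₂ h₁ h hP hP₁.1)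

theorem strict_of_score_lt (hA : Anonymous m k F.rel) (hN : Neutral m k F.rel)
    (hC : Consistent m k F.rel) (hW : WeakEfficient m k F.rel) {f : ℕ → ℕ → ℝ}
    (hadj : ∀ (W₁ W₂ : Finset (Fin m)), W₁.card = k → W₂.card = k → (W₁ \ W₂).card = 1 →
      ∀ A, F.rel A W₁ W₂ ↔ score f W₂ A ≤ score f W₁ A)
    (hsep : ∀ W₁ W₂ : Finset (Fin m), W₁.card = k → W₂.card = k → W₁ ≠ W₂ →
      ∃ S, score f W₂ [S] < score f W₁ [S])
    {W₁ W₂ : Finset (Fin m)} (h₁ : W₁.card = k) (h₂ : W₂.card = k) {A : Profile m}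
    (hlt : score f W₂ A < score f W₁ A) : strictOf F.rel A W₁ W₂ := by
  obtain ⟨d, hd⟩ : ∃ d, (W₁ \ W₂).card = d := ⟨_, rfl⟩
  induction d using Nat.strong_induction_on generalizing W₁ W₂ A with
  | _ d ih =>
  rcases Nat.lt_trichotomy d 1 with hd₁ | rfl | hd₁
  · have hsub : W₁ ⊆ W₂ := by
      rw [← Finset.sdiff_eq_empty_iff_subset, ← Finset.card_eq_zero]
      omega
    rw [Finset.eq_of_subset_of_card_le hsub (by omega)] at hlt
    exact absurd hlt (lt_irrefl _)
  · rw [F.strictOf_iff A h₁ h₂, hadj W₂ W₁ h₂ h₁ (by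
      rw [Finset.card_sdiff_comm (h₂.trans h₁.symm), hd])]
    exact not_le.2 hlt
  · obtain ⟨a, ha, b, hb, hab⟩ := Finset.one_lt_card.1 (hd.symm ▸ hd₁)
    obtain ⟨τ, hτ, hτ₁, hτ₂⟩ := exists_involutive_image_eq (h₁.trans h₂.symm)
    rw [Finset.mem_sdiff] at ha hb
    have hmem (x : Fin m) (hx : x ∈ W₁ ∧ x ∉ W₂) : τ x ∈ W₂ ∧ τ x ∉ W₁ := by
      rw [← mem_image_of_involutive hτ, ← mem_image_of_involutive hτ, hτ₁, hτ₂]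
      exact hx
    obtain ⟨hc, hc'⟩ := hmem b hb
    obtain ⟨he, he'⟩ := hmem a ha
    have hτab : τ a ≠ τ b := τ.injective.ne hab
    let ρ : Equiv.Perm (Fin m) := Equiv.swap (τ a) (τ b)
    have hρ : Function.Involutive ρ := Equiv.swap_apply_self _ _
    have hρ_image (V : Finset (Fin m)) (hV : τ a ∈ V ↔ τ b ∈ V) : V.image ρ = V := by
      ext x
      rw [mem_image_of_involutive hρ]
      by_cases hxa : x = τ a
      · simp [ρ, hxa, hV]
      by_cases hxb : x = τ b
      · simp [ρ, hxb, hV]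
      rw [Equiv.swap_apply_of_ne_of_ne hxa hxb]
    let τ' : Equiv.Perm (Fin m) := ρ * τ * ρ
    have hτ' : Function.Involutive τ' := fun x => by
      simp only [τ', Equiv.Perm.mul_apply, hρ _, hτ _]
    have hτ'₁ : W₁.image τ' = W₂ := by
      rw [Equiv.Perm.coe_mul, Equiv.Perm.coe_mul, ← Finset.image_image, ← Finset.image_image,
        hρ_image W₁ (by tauto), hτ₁, hρ_image W₂ (by tauto)]
    let W := insert (τ b) (W₁.erase b)
    obtain ⟨hWcard, hd₁', hd₂'⟩ := card_exchange hb ⟨hc, hc'⟩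
    rw [h₁] at hWcard
    rw [hd] at hd₂'
    have hne : W.image τ ≠ W.image τ' := by
      intro heq
      have h := mem_image_of_involutive hτ' W a
      rw [← heq, mem_image_of_involutive hτ W a] at h
      have hρa : ρ a = a := Equiv.swap_apply_of_ne_of_ne (by grind) (by grind)
      have hτ'a : τ' a = τ b := by
        simp [τ', hρa, ρ]
      rw [hτ'a] at h
      have : τ a ∈ W := h.2 (Finset.mem_insert_self _ _)
      simp [W, hτab, he'] at this
    have hstrict₁ (A : Profile m) (hA : score f W A < score f W₁ A) : strictOf F.rel A W₁ W :=
      ih 1 hd₁ h₁ hWcard hA hd₁'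
    have hstrict₂ (A : Profile m) (hA : score f W₂ A < score f W A) : strictOf F.rel A W W₂ :=
      ih (d - 1) (by omega) hWcard h₂ hA hd₂'
    obtain ⟨S, hS⟩ := hsep (W.image τ) (W.image τ')
      (by rw [Finset.card_image_of_injective _ τ.injective, hWcard])
      (by rw [Finset.card_image_of_injective _ τ'.injective, hWcard]) hne
    by_cases hsum : score f W₁ [S] + score f W₂ [S] = score f W [S] + score f (W.image τ) [S]
    · refine strict_of_symmetric_path hA hN hC hW h₁ h₂ hWcard hτ' hτ'₁ (S := S) ?_ hstrict₁
        hstrict₂ hlt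
      intro h
      linarith
    · exact strict_of_symmetric_path hA hN hC hW h₁ h₂ hWcard hτ hτ₁ hsum hstrict₁ hstrict₂ hlt

theorem rel_of_adjacent_tied
    (hadj : ∀ (W₁ W₂ : Finset (Fin m)), W₁.card = k → W₂.card = k → (W₁ \ W₂).card = 1 →
      ∀ A, F.rel A W₁ W₂)
    {W₁ W₂ : Finset (Fin m)} (h₁ : W₁.card = k) (h₂ : W₂.card = k) (A : Profile m) :
    F.rel A W₁ W₂ := by
  obtain ⟨d, hd⟩ : ∃ d, (W₁ \ W₂).card = d := ⟨_, rfl⟩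
  induction d generalizing W₁ with
  | zero =>
    rw [Finset.card_eq_zero, Finset.sdiff_eq_empty_iff_subset] at hd
    rw [Finset.eq_of_subset_of_card_le hd (by omega)]
    exact F.rel_refl A h₂
  | succ d ih =>
    obtain ⟨b, hb⟩ : (W₁ \ W₂).Nonempty := Finset.card_pos.1 (by omega)
    obtain ⟨c, hc⟩ : (W₂ \ W₁).Nonempty :=
      Finset.card_pos.1 (by rw [Finset.card_sdiff_comm (h₂.trans h₁.symm)]; omega)
    obtain ⟨hcard, hd₁, hd₂⟩ := card_exchange (Finset.mem_sdiff.1 hb) (Finset.mem_sdiff.1 hc)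
    rw [h₁] at hcard
    rw [hd, Nat.add_sub_cancel] at hd₂
    exact F.trans _ _ _ _ h₁ hcard h₂ (hadj _ _ h₁ hcard hd₁ A) (ih hcard hd₂)

theorem isCountingRule_of_consistent (hk : 0 < k) (hkm : k < m) (hA : Anonymous m k F.rel)
    (hN : Neutral m k F.rel) (hC : Consistent m k F.rel) (hW : WeakEfficient m k F.rel)
    (hCt : Continuous m k F.rel) : IsCountingRule m k F := by
  obtain ⟨f, hmono, hadj, hf⟩ := exists_adjacent_counting_function hk hkm hA hN hC hW hCt
  refine ⟨f, fun x x' y hx _ _ => hmono x x' y hx, fun A W₁ W₂ h₁ h₂ => ?_⟩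
  rcases hf with hf | ⟨p, y, hp, hpk, hpy, hy, hlt⟩
  · have hscore (W : Finset (Fin m)) (A : Profile m) : score f W A = 0 := by
      simp [score, hf]
    have hrel := rel_of_adjacent_tied (F := F)
      (fun W₁ W₂ h₁ h₂ hd A => (hadj W₁ W₂ h₁ h₂ hd A).2 (by rw [hscore, hscore])) h₂ h₁ A
    simp only [hscore, lt_irrefl, false_iff]
    exact fun h => h.2 hrel
  have hsep (W₁ W₂ : Finset (Fin m)) (h₁ : W₁.card = k) (h₂ : W₂.card = k) (hne : W₁ ≠ W₂) :
      ∃ S, score f W₂ [S] < score f W₁ [S] := by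
    obtain ⟨S, hS, hS₁, hS₂⟩ := exists_ballot_separating h₁ h₂ hne hp hpk hpy hy
    refine ⟨S, ?_⟩
    simp only [score_cons, score_nil, add_zero, hS]
    exact ((hmono _ _ _ (by omega)).trans_lt hlt).trans_le (hmono _ _ _ hS₁)
  have hstrict {W₁ W₂ : Finset (Fin m)} (h₁ : W₁.card = k) (h₂ : W₂.card = k) {A : Profile m} :
      score f W₂ A < score f W₁ A → strictOf F.rel A W₁ W₂ :=
    strict_of_score_lt hA hN hC hW hadj hsep h₁ h₂
  refine ⟨hstrict h₁ h₂, fun h => ?_⟩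
  by_contra! hle
  rcases hle.lt_or_eq with hlt' | heq
  · exact h.2 (hstrict h₂ h₁ hlt').1
  · obtain ⟨S, hS⟩ := hsep W₂ W₁ h₂ h₁ fun h' => h.2 (h' ▸ h.1)
    obtain ⟨n, hn⟩ := hCt [S] A W₁ W₂ h₁ h₂ h
    exact hn.2 (hstrict h₂ h₁ (by simpa [score_append, heq] using hS)).1

end Extension

/-- An ABC ranking rule is an ABC counting rule if and only if it
satisfies symmetry (anonymity and neutrality), consistency, weak efficiency,
and continuity. -/
theorem statement0 (m k : ℕ) (hk : 0 < k) (hkm : k < m) (F : ABCRankingRule m k) :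
    IsCountingRule m k F ↔
      (Anonymous m k F.rel ∧ Neutral m k F.rel) ∧ Consistent m k F.rel ∧
        WeakEfficient m k F.rel ∧ Continuous m k F.rel := by
  exact ⟨IsCountingRule.symmetric_consistent_efficient_continuous,
    fun ⟨⟨hA, hN⟩, hC, hW, hCt⟩ =>
      isCountingRule_of_consistent hk hkm hA hN hC hW hCt⟩

end ABC
end

section
/- Let D_{m,k} = {(x,y) ∈ {0,…,k}×{0,…,m−1} : x ≤ y and k−x ≤ m−y}, and let f, g be counting functions. If there exist a real constant c > 0 and a function d : {0,…,m} → ℝ such that f(x,y) = c·g(x,y) + d(y) for all (x,y) ∈ D_{m,k}, then f and g yield the same ABC counting rule: for every approval profile A and all committees W1, W2, score_f(W1,A) > score_f(W2,A) if and only if score_g(W1,A) > score_g(W2,A). -/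
namespace ABC

/-- The pair `(|s ∩ W|, |s|)` satisfies the constraint `k - x ≤ m - y`
for every ballot `s` and every committee `W` of size `k`. -/
theorem card_sub_card_inter_le {m k : ℕ} (s W : Finset (Fin m)) (hW : W.card = k) :
    k - (s ∩ W).card ≤ m - s.card := by
  have hunion := Finset.card_union_add_card_inter s W
  have hle : (s ∪ W).card ≤ m := by simpa using Finset.card_le_univ (s ∪ W)
  omega

/-- Under an affine relation on the relevant domain, score differences scale by `c`. -/
theorem score_sub_score_eq {m k : ℕ} {f g : ℕ → ℕ → ℝ} {c : ℝ} {d : ℕ → ℝ}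
    (h : ∀ x y : ℕ, x ≤ k → y ≤ m - 1 → x ≤ y → k - x ≤ m - y →
      f x y = c * g x y + d y)
    {W1 W2 : Finset (Fin m)} (hW1 : W1.card = k) (hW2 : W2.card = k) (A : Profile m) :
    score f W1 A - score f W2 A = c * (score g W1 A - score g W2 A) := by
  have ballot (s : Finset (Fin m)) :
      f (s ∩ W1).card s.card - f (s ∩ W2).card s.card =
        c * (g (s ∩ W1).card s.card - g (s ∩ W2).card s.card) := by
    by_cases hs : s = Finset.univ
    · simp [hs, hW1, hW2]
    have hlt : s.card < m := by
      simpa using (Finset.card_lt_iff_ne_univ s).2 hs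
    have affine (W : Finset (Fin m)) (hW : W.card = k) :
        f (s ∩ W).card s.card = c * g (s ∩ W).card s.card + d s.card :=
      h _ _ (hW ▸ Finset.card_le_card Finset.inter_subset_right) (by omega)
        (Finset.card_le_card Finset.inter_subset_left) (card_sub_card_inter_le s W hW)
    rw [affine W1 hW1, affine W2 hW2]
    ring
  induction A with
  | nil => simp [score]
  | cons s A ih =>
    simp only [score, List.map_cons, List.sum_cons] at ih ⊢
    linarith [ballot s]

/-- if `f(x,y) = c·g(x,y) + d(y)` on the relevant domain
`D_{m,k} = {(x,y) : x ≤ k, y ≤ m-1, x ≤ y, k-x ≤ m-y}` with `c > 0`, then the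
counting functions `f` and `g` induce the same comparisons of committees. -/
theorem statement1 (m k : ℕ) (hk : 0 < k) (hkm : k < m)
    (f g : ℕ → ℕ → ℝ) (hf : IsCountingFunction m k f) (hg : IsCountingFunction m k g)
    (c : ℝ) (hc : 0 < c) (d : ℕ → ℝ)
    (h : ∀ x y : ℕ, x ≤ k → y ≤ m - 1 → x ≤ y → k - x ≤ m - y →
      f x y = c * g x y + d y) :
    ∀ (A : Profile m) (W1 W2 : Finset (Fin m)), W1.card = k → W2.card = k →
      (score f W2 A < score f W1 A ↔ score g W2 A < score g W1 A) := by
  intro A W1 W2 hW1 hW2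
  rw [← sub_pos, score_sub_score_eq h hW1 hW2, mul_pos_iff_of_pos_left hc, sub_pos]

end ABC
end

section
/- Every ABC ranking rule that satisfies neutrality, consistency, and weak efficiency also satisfies efficiency. -/
namespace ABC

section SingleBallot

variable {m k : ℕ} (F : ABCRankingRule m k)

/-- If `a` and `b` are both approved, exchanging them does not change the rank of a committee. -/
theorem rel_image_swap (hN : Neutral m k F.rel) {s W : Finset (Fin m)} (hWk : W.card = k)
    {a b : Fin m} (ha : a ∈ s) (hb : b ∈ s) :
    F.rel [s] W (W.image (Equiv.swap a b)) := by
  have hk' : (W.image (Equiv.swap a b)).card = k := by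
    rw [Finset.card_image_of_injective _ (Equiv.injective _), hWk]
  have hs : s.image (Equiv.swap a b) = s := by
    ext x
    simp only [Finset.mem_image]
    constructor
    · rintro ⟨y, hy, rfl⟩
      rw [Equiv.swap_apply_def]
      split_ifs <;> assumption
    · intro hx
      refine ⟨Equiv.swap a b x, ?_, Equiv.swap_apply_self a b x⟩
      rw [Equiv.swap_apply_def]
      split_ifs <;> assumption
  have hWW : (W.image (Equiv.swap a b)).image (Equiv.swap a b) = W := by
    rw [Finset.image_image]
    simp [Function.comp_def]
  rcases F.total [s] W (W.image (Equiv.swap a b)) hWk hk' with h | h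
  · exact h
  · have h' := (hN (Equiv.swap a b) [s] _ _ hk' hWk).1 h
    simpa only [List.map_cons, List.map_nil, hs, hWW] using h'

/-- Committees that agree outside the ballot are tied. -/
theorem rel_of_sdiff_eq (hN : Neutral m k F.rel) {s W' : Finset (Fin m)} (hWk' : W'.card = k)
    (n : ℕ) (W : Finset (Fin m)) (hWk : W.card = k) (hs : W \ s = W' \ s)
    (hn : (W \ W').card = n) : F.rel [s] W W' := by
  induction n generalizing W with
  | zero =>
    have hsub : W ⊆ W' := Finset.sdiff_eq_empty_iff_subset.1 (Finset.card_eq_zero.1 hn)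
    obtain rfl : W = W' := Finset.eq_of_subset_of_card_le hsub (by omega)
    exact (F.total [s] W W hWk hWk).elim id id
  | succ n ih =>
    have hcard : (W' \ W).card = n + 1 := by
      rw [← hn]
      exact Finset.card_sdiff_comm (hWk'.trans hWk.symm)
    obtain ⟨a, ha⟩ := Finset.card_pos.1 (by omega : 0 < (W \ W').card)
    obtain ⟨b, hb⟩ := Finset.card_pos.1 (by omega : 0 < (W' \ W).card)
    have hs' : ∀ x, x ∉ s → (x ∈ W ↔ x ∈ W') := fun x hx => by
      simpa [hx] using Finset.ext_iff.1 hs x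
    rw [Finset.mem_sdiff] at ha hb
    have has : a ∈ s := by
      by_contra h
      exact ha.2 ((hs' a h).1 ha.1)
    have hbs : b ∈ s := by
      by_contra h
      exact hb.2 ((hs' b h).2 hb.1)
    have hmem : ∀ x, x ∈ W.image (Equiv.swap a b) ↔ x = b ∨ (x ≠ a ∧ x ∈ W) := by
      intro x
      rw [← Equiv.coe_toEmbedding, ← Finset.map_eq_image, Finset.mem_map_equiv,
        Equiv.symm_swap, Equiv.swap_apply_def]
      clear ih hn hcard
      split_ifs <;> grind
    have hk' : (W.image (Equiv.swap a b)).card = k := by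
      rw [Finset.card_image_of_injective _ (Equiv.injective _), hWk]
    refine F.trans [s] W _ W' hWk hk' hWk' (rel_image_swap F hN hWk has hbs) (ih _ hk' ?_ ?_)
    · ext x
      rw [Finset.mem_sdiff, hmem, Finset.mem_sdiff]
      grind
    · have h : W.image (Equiv.swap a b) \ W' = (W \ W').erase a := by
        ext x
        rw [Finset.mem_sdiff, hmem, Finset.mem_erase, Finset.mem_sdiff]
        grind
      rw [h, Finset.card_erase_of_mem (Finset.mem_sdiff.2 ha), hn, Nat.add_sub_cancel]

/-- Efficiency for a single voter. -/
theorem rel_singleton_of_card_inter_le (hN : Neutral m k F.rel) (hW : WeakEfficient m k F.rel)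
    {s W1 W2 : Finset (Fin m)} (h1 : W1.card = k) (h2 : W2.card = k)
    (h : (s ∩ W2).card ≤ (s ∩ W1).card) : F.rel [s] W1 W2 := by
  obtain ⟨T, hT, hTc⟩ := Finset.exists_subset_card_eq h
  have hTs : ∀ x ∈ T, x ∈ s ∧ x ∈ W1 := fun x hx => Finset.mem_inter.1 (hT hx)
  have h3 : (T ∪ W2 \ s).card = k := by
    have hdisj : Disjoint T (W2 \ s) :=
      Finset.disjoint_left.2 fun x hx hx' => (Finset.mem_sdiff.1 hx').2 (hTs x hx).1
    rw [Finset.card_union_of_disjoint hdisj, hTc, Finset.inter_comm,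
      Finset.card_inter_add_card_sdiff, h2]
  refine F.trans [s] W1 (T ∪ W2 \ s) W2 h1 h3 h2 (hW _ _ _ h1 h3 ?_)
    (rel_of_sdiff_eq F hN h2 _ _ h3 ?_ rfl)
  · intro t ht c hc hc1 hct
    rw [List.mem_singleton] at ht
    subst ht
    grind
  · grind

end SingleBallot

/-- every ABC ranking rule satisfying neutrality, consistency, and
weak efficiency also satisfies efficiency. -/
theorem statement2 (m k : ℕ) (hk : 0 < k) (hkm : k < m) (F : ABCRankingRule m k)
    (hN : Neutral m k F.rel) (hC : Consistent m k F.rel)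
    (hW : WeakEfficient m k F.rel) :
    Efficient m k F.rel := by
  intro A W1 W2 h1 h2 h
  induction A with
  | nil => exact hW [] W1 W2 h1 h2 (by simp)
  | cons s A ih =>
    exact (hC [s] A W1 W2 h1 h2).2
      (rel_singleton_of_card_inter_le F hN hW h1 h2 (h s List.mem_cons_self))
      (ih fun t ht => h t (List.mem_cons_of_mem s ht))

end ABC
end

section
/- The Approval Chamberlin–Courant rule is the only non-trivial ABC counting rule that satisfies disjoint diversity: (1) the ABC counting rule implemented by f_CC satisfies disjoint diversity and is non-trivial, and (2) every non-trivial ABC counting rule F satisfying disjoint diversity coincides with the Approval Chamberlin–Courant rule, i.e., for every approval profile A and all committees W1, W2, W1 ≻_{F(A)} W2 if and only if score_{f_CC}(W1,A) > score_{f_CC}(W2,A). -/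
namespace ABC

section Rules

variable {m k : ℕ} {F : ABCRankingRule m k} {f : ℕ → ℕ → ℝ}

lemma Implements.rel_iff_s7 (hF : Implements m k f F) {A : Profile m} {W W' : Finset (Fin m)}
    (hW : W.card = k) (hW' : W'.card = k) : F.rel A W W' ↔ score f W' A ≤ score f W A := by
  have h := hF A W' W hW' hW
  have ht := F.total A W W' hW hW'
  rw [← not_lt, h, ABCRankingRule.strict, strictOf]
  tauto

lemma Implements.winning_iff (hF : Implements m k f F) {A : Profile m} {W : Finset (Fin m)} :
    Winning m k F A W ↔
      W.card = k ∧ ∀ W' : Finset (Fin m), W'.card = k → score f W' A ≤ score f W A :=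
  and_congr_right fun hW => forall₂_congr fun _ hW' => hF.rel_iff_s7 hW hW'

end Rules

section PartyLists

variable {m p : ℕ} {A : Profile m} {Cs : Fin p → Finset (Fin m)}

lemma injective_of_pairwise_disjoint (hne : ∀ i, (Cs i).Nonempty)
    (hdisj : ∀ i j, i ≠ j → Disjoint (Cs i) (Cs j)) : Function.Injective Cs := by
  intro i j hij
  by_contra h
  have := hdisj i j h
  rw [hij, disjoint_self] at this
  exact (hne j).ne_empty this

lemma IsPartyList.score_eq (h : IsPartyList m A p Cs) (f : ℕ → ℕ → ℝ) (W : Finset (Fin m)) :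
    score f W A = ∑ i, (partySize A Cs i : ℝ) * f (Cs i ∩ W).card (Cs i).card := by
  have hinj := injective_of_pairwise_disjoint h.1 h.2.1
  have himage : A.toFinset = Finset.univ.image Cs := by
    ext s
    simp only [List.mem_toFinset, Finset.mem_image, Finset.mem_univ, true_and]
    constructor
    · intro hs
      obtain ⟨i, hi⟩ := h.2.2.1 s hs
      exact ⟨i, hi.symm⟩
    · rintro ⟨i, rfl⟩
      exact h.2.2.2 i
  rw [score, Finset.sum_list_map_count, himage, Finset.sum_image hinj.injOn]
  simp [partySize, nsmul_eq_mul]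

/-- The profile in which party `i` has `n i` voters, all approving `Cs i`. -/
def partyProfile (Cs : Fin p → Finset (Fin m)) (n : Fin p → ℕ) : Profile m :=
  (List.finRange p).flatMap fun i => List.replicate (n i) (Cs i)

lemma partySize_partyProfile (hinj : Function.Injective Cs) (n : Fin p → ℕ) (i : Fin p) :
    partySize (partyProfile Cs n) Cs i = n i := by
  have hcount : ∀ j, List.count (Cs i) (List.replicate (n j) (Cs j)) = if j = i then n i else 0 := by
    intro j
    rw [List.count_replicate]
    by_cases h : j = i
    · simp [h]
    · simp [h, hinj.eq_iff]
  simp only [partySize, partyProfile, List.count_flatMap, Function.comp_def, hcount]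
  rw [← List.ofFn_eq_map, List.sum_ofFn]
  simp

lemma isPartyList_partyProfile (hne : ∀ i, (Cs i).Nonempty)
    (hdisj : ∀ i j, i ≠ j → Disjoint (Cs i) (Cs j)) {n : Fin p → ℕ} (hn : ∀ i, n i ≠ 0) :
    IsPartyList m (partyProfile Cs n) p Cs := by
  refine ⟨hne, hdisj, fun s hs => ?_, fun i => ?_⟩
  · simp only [partyProfile, List.mem_flatMap, List.mem_replicate] at hs
    obtain ⟨i, -, -, hi⟩ := hs
    exact ⟨i, hi⟩
  · simp only [partyProfile, List.mem_flatMap, List.mem_replicate]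
    exact ⟨i, List.mem_finRange i, hn i, rfl⟩

lemma DisjointDiversity.exists_committee {k : ℕ} {F : ABCRankingRule m k} {f : ℕ → ℕ → ℝ}
    (hD : DisjointDiversity m k F) (hF : Implements m k f F) (hne : ∀ i, (Cs i).Nonempty)
    (hdisj : ∀ i j, i ≠ j → Disjoint (Cs i) (Cs j)) {n : Fin p → ℕ} (hn : ∀ i, n i ≠ 0)
    (hmono : Antitone n) :
    ∃ W : Finset (Fin m), W.card = k ∧ (∀ i : Fin p, (i : ℕ) < k → (W ∩ Cs i).Nonempty) ∧
      ∀ W' : Finset (Fin m), W'.card = k →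
        ∑ i, (n i : ℝ) * f (Cs i ∩ W').card (Cs i).card ≤
          ∑ i, (n i : ℝ) * f (Cs i ∩ W).card (Cs i).card := by
  have hinj := injective_of_pairwise_disjoint hne hdisj
  have hA := isPartyList_partyProfile hne hdisj hn
  obtain ⟨W, hW, hit⟩ := hD _ p Cs hA fun i j hij => by
    simpa only [partySize_partyProfile hinj] using hmono hij
  obtain ⟨hWk, hmax⟩ := hF.winning_iff.1 hW
  refine ⟨W, hWk, hit, fun W' hW' => ?_⟩
  simpa only [hA.score_eq, partySize_partyProfile hinj] using hmax W' hW'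

end PartyLists

section ChamberlinCourant

lemma sum_le_sum_of_initial {p k : ℕ} {N : Fin p → ℕ} (hN : Antitone N) {H : Finset (Fin p)}
    (hH : H.card ≤ k) : ∑ i ∈ H, N i ≤ ∑ i with i.val < k, N i := by
  rcases le_or_gt p k with hpk | hpk
  · refine Finset.sum_le_sum_of_subset fun i _ => ?_
    simpa using i.2.trans_le hpk
  · set T : Finset (Fin p) := Finset.univ.filter fun i => i.val < k with hT
    have hTcard : T.card = k := by
      rw [hT, Fin.card_filter_val_lt, min_eq_right hpk.le]
    have hsplit : (H \ T).card ≤ (T \ H).card :=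
      Finset.card_sdiff_le_card_sdiff_iff.2 (hH.trans hTcard.ge)
    have hupper : ∑ i ∈ H \ T, N i ≤ (H \ T).card * N ⟨k, hpk⟩ := by
      refine Finset.sum_le_card_nsmul _ _ _ fun i hi => hN ?_
      rw [Fin.le_def]
      simpa [hT] using (Finset.mem_sdiff.1 hi).2
    have hlower : (T \ H).card * N ⟨k, hpk⟩ ≤ ∑ i ∈ T \ H, N i := by
      refine Finset.card_nsmul_le_sum _ _ _ fun i hi => hN ?_
      rw [Fin.le_def]
      have : i.val < k := by simpa [hT] using (Finset.mem_sdiff.1 hi).1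
      exact this.le
    have hmul := Nat.mul_le_mul_right (N ⟨k, hpk⟩) hsplit
    rw [← Finset.sum_inter_add_sum_sdiff H T, ← Finset.sum_inter_add_sum_sdiff T H,
      Finset.inter_comm T H]
    omega

variable {m k p : ℕ} {A : Profile m} {Cs : Fin p → Finset (Fin m)}

lemma IsPartyList.score_fCC (h : IsPartyList m A p Cs) (W : Finset (Fin m)) :
    score fCC W A = ((∑ i with (W ∩ Cs i).Nonempty, partySize A Cs i : ℕ) : ℝ) := by
  rw [h.score_eq, Nat.cast_sum, Finset.sum_filter]
  refine Finset.sum_congr rfl fun i _ => ?_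
  rw [Finset.inter_comm]
  by_cases hi : (W ∩ Cs i).Nonempty
  · simp [fCC, hi, hi.ne_empty]
  · simp [fCC, Finset.not_nonempty_iff_eq_empty.1 hi]

lemma card_filter_inter_nonempty_le (hdisj : ∀ i j, i ≠ j → Disjoint (Cs i) (Cs j))
    (W : Finset (Fin m)) :
    (Finset.univ.filter fun i => (W ∩ Cs i).Nonempty).card ≤ W.card := by
  refine Finset.card_le_card_of_forall_subsingleton (fun i c => c ∈ Cs i) (fun i hi => ?_)
    fun c _ i hi j hj => ?_
  · obtain ⟨c, hc⟩ := (Finset.mem_filter.1 hi).2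
    exact ⟨c, Finset.mem_inter.1 hc⟩
  · by_contra hij
    exact Finset.disjoint_left.1 (hdisj i j hij) hi.2 hj.2

lemma disjointDiversity_of_implements_fCC (hkm : k ≤ m) {F : ABCRankingRule m k}
    (hF : Implements m k fCC F) : DisjointDiversity m k F := by
  intro A p Cs hA hsize
  choose c hc using hA.1
  set S : Finset (Fin m) := (Finset.univ.filter fun i : Fin p => i.val < k).image c with hS
  have hScard : S.card ≤ k := by
    refine Finset.card_image_le.trans ?_
    rw [Fin.card_filter_val_lt]
    exact min_le_right _ _
  obtain ⟨W, hSW, hW⟩ := Finset.exists_superset_card_eq hScard (by simpa using hkm)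
  have hit : ∀ i : Fin p, (i : ℕ) < k → (W ∩ Cs i).Nonempty := fun i hi =>
    ⟨c i, Finset.mem_inter.2 ⟨hSW (Finset.mem_image_of_mem c (by simpa using hi)), hc i⟩⟩
  refine ⟨W, hF.winning_iff.2 ⟨hW, fun W' hW' => ?_⟩, hit⟩
  rw [hA.score_fCC, hA.score_fCC, Nat.cast_le]
  refine (sum_le_sum_of_initial hsize
    ((card_filter_inter_nonempty_le hA.2.1 W').trans hW'.le)).trans ?_
  refine Finset.sum_le_sum_of_subset fun i hi => ?_
  simp only [Finset.mem_filter, Finset.mem_univ, true_and] at hi ⊢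
  exact hit i hi

lemma not_isTrivialRule_of_implements_fCC (hk : 0 < k) (hkm : k < m) {F : ABCRankingRule m k}
    (hF : Implements m k fCC F) : ¬ IsTrivialRule m k F := by
  intro htriv
  let c : Fin m := ⟨0, by omega⟩
  obtain ⟨W, hcW, hW⟩ := Finset.exists_superset_card_eq (s := {c}) (n := k)
    (by simpa using Nat.succ_le_of_lt hk)
    (by simpa using hkm.le)
  obtain ⟨W', hcW', hW'⟩ := Finset.exists_subset_card_eq (s := ({c}ᶜ : Finset (Fin m))) (n := k)
    (by rw [Finset.card_compl]; simp; omega)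
  have h := (hF.rel_iff_s7 hW' hW).1 (htriv [{c}] W' W hW' hW)
  have hc : c ∈ W := hcW (Finset.mem_singleton_self c)
  have hc' : c ∉ W' := fun h => by simpa using hcW' h
  simp [score, fCC, Finset.singleton_inter_of_mem hc, Finset.singleton_inter_of_notMem hc'] at h
  linarith

end ChamberlinCourant

section Uniqueness

variable {m k : ℕ} {F : ABCRankingRule m k} {f : ℕ → ℕ → ℝ}

lemma sum_singleton_inter (f : ℕ → ℕ → ℝ) {s : ℕ} {S : Finset (Fin m)} (e : Fin s ≃ S)
    (W : Finset (Fin m)) :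
    ∑ i, f (({(e i : Fin m)} : Finset (Fin m)) ∩ W).card 1 =
      (S ∩ W).card * (f 1 1 - f 0 1) + S.card * f 0 1 := by
  have hterm : ∀ c : Fin m, f (({c} : Finset (Fin m)) ∩ W).card 1 =
      (if c ∈ W then f 1 1 - f 0 1 else 0) + f 0 1 := fun c => by
    by_cases hc : c ∈ W
    · simp [hc, Finset.singleton_inter_of_mem]
    · simp [hc, Finset.singleton_inter_of_notMem]
  rw [Equiv.sum_comp e fun c : S => f (({(c : Fin m)} : Finset (Fin m)) ∩ W).card 1,
    Finset.sum_coe_sort S fun c => f (({c} : Finset (Fin m)) ∩ W).card 1]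
  simp only [hterm]
  rw [Finset.sum_add_distrib, ← Finset.sum_filter, Finset.filter_mem_eq_inter]
  simp [nsmul_eq_mul, mul_sub]

/-- One large party `C` followed by the singleton parties of `S`. -/
lemma DisjointDiversity.exists_committee_cons (hD : DisjointDiversity m k F)
    (hF : Implements m k f F) {C S : Finset (Fin m)} (hC : C.Nonempty) (hCS : Disjoint C S)
    {n : ℕ} (hn : 0 < n) :
    ∃ W : Finset (Fin m), W.card = k ∧ (0 < k → (C ∩ W).Nonempty) ∧ (S.card < k → S ⊆ W) ∧
      ∀ W' : Finset (Fin m), W'.card = k →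
        n * f (C ∩ W').card C.card + (S ∩ W').card * (f 1 1 - f 0 1) ≤
          n * f (C ∩ W).card C.card + (S ∩ W).card * (f 1 1 - f 0 1) := by
  let e := S.equivFin.symm
  let Cs : Fin (S.card + 1) → Finset (Fin m) := Fin.cons C fun i => {(e i : Fin m)}
  let N : Fin (S.card + 1) → ℕ := Fin.cons n fun _ => 1
  have heC : ∀ i, (e i : Fin m) ∉ C := fun i h =>
    Finset.disjoint_left.1 hCS h (e i).2
  obtain ⟨W, hW, hit, hmax⟩ := hD.exists_committee (Cs := Cs) (n := N) hF
    (by intro i; cases i using Fin.cases <;> simp [Cs, hC])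
    (by
      intro i j hij
      cases i using Fin.cases <;> cases j using Fin.cases
      · exact absurd rfl hij
      · simp [Cs, heC]
      · simp [Cs, heC]
      · simpa [Cs, Subtype.val_inj, eq_comm] using hij)
    (by intro i; cases i using Fin.cases <;> simp [N, hn.ne'])
    (by
      intro i j hij
      cases i using Fin.cases <;> cases j using Fin.cases
      · rfl
      · simpa [N] using Nat.succ_le_of_lt hn
      · simp at hij
      · simp [N])
  refine ⟨W, hW, fun hk => ?_, fun hS c hc => ?_, fun W' hW' => ?_⟩
  · simpa [Cs, Finset.inter_comm] using hit 0 hk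
  · have := hit (S.equivFin ⟨c, hc⟩).succ (by
      rw [Fin.val_succ]
      exact lt_of_le_of_lt (Nat.succ_le_of_lt (Fin.is_lt _)) hS)
    obtain ⟨d, hd⟩ := this
    simp only [Cs, e, Fin.cons_succ, Equiv.symm_apply_apply, Finset.mem_inter,
      Finset.mem_singleton] at hd
    exact hd.2 ▸ hd.1
  · have := hmax W' hW'
    simp only [Fin.sum_univ_succ, Cs, N, Fin.cons_zero, Fin.cons_succ, Nat.cast_one, one_mul,
      Finset.card_singleton, sum_singleton_inter] at this
    linarith

/-- The singleton parties of a committee `S` followed by a party `C`. -/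
lemma DisjointDiversity.score_le_of_snoc (hD : DisjointDiversity m k F)
    (hF : Implements m k f F) {C S : Finset (Fin m)} (hC : C.Nonempty) (hCS : Disjoint C S)
    (hS : S.card = k) {W' : Finset (Fin m)} (hW' : W'.card = k) :
    f (C ∩ W').card C.card + (S ∩ W').card * (f 1 1 - f 0 1) ≤
      f 0 C.card + k * (f 1 1 - f 0 1) := by
  let e := S.equivFin.symm
  let Cs : Fin (S.card + 1) → Finset (Fin m) :=
    Fin.snoc (α := fun _ => Finset (Fin m)) (fun i => {(e i : Fin m)}) C
  have heC : ∀ i, (e i : Fin m) ∉ C := fun i h =>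
    Finset.disjoint_left.1 hCS h (e i).2
  obtain ⟨W, hW, hit, hmax⟩ := hD.exists_committee (Cs := Cs) (n := fun _ => 1) hF
    (by intro i; cases i using Fin.lastCases <;> simp [Cs, hC])
    (by
      intro i j hij
      cases i using Fin.lastCases <;> cases j using Fin.lastCases
      · exact absurd rfl hij
      · simp [Cs, heC]
      · simp [Cs, heC]
      · simpa [Cs, Subtype.val_inj, eq_comm] using hij)
    (fun _ => one_ne_zero) antitone_const
  have hSW : S ⊆ W := fun c hc => by
    have := hit (S.equivFin ⟨c, hc⟩).castSucc (by
      rw [Fin.val_castSucc, ← hS]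
      exact Fin.is_lt _)
    obtain ⟨d, hd⟩ := this
    simp only [Cs, e, Fin.snoc_castSucc, Equiv.symm_apply_apply, Finset.mem_inter,
      Finset.mem_singleton] at hd
    exact hd.2 ▸ hd.1
  obtain rfl := Finset.eq_of_subset_of_card_le hSW (hW.trans hS.symm).le
  have := hmax W' hW'
  simp only [Fin.sum_univ_castSucc, Cs, Fin.snoc_last, Fin.snoc_castSucc, Nat.cast_one, one_mul,
    Finset.card_singleton, sum_singleton_inter, Finset.disjoint_iff_inter_eq_empty.1 hCS,
    Finset.inter_self, Finset.card_empty, hS] at this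
  linarith

lemma exists_disjoint_pair {a b : ℕ} (hab : a + b ≤ m) :
    ∃ C S : Finset (Fin m), C.card = a ∧ S.card = b ∧ Disjoint C S := by
  obtain ⟨C, -, hC⟩ := Finset.exists_subset_card_eq (s := (Finset.univ : Finset (Fin m))) (n := a)
    (by simp; omega)
  obtain ⟨S, hSC, hS⟩ := Finset.exists_subset_card_eq (s := Cᶜ) (n := b)
    (by rw [Finset.card_compl, Fintype.card_fin, hC]; omega)
  exact ⟨C, S, hC, hS, (Finset.subset_compl_iff_disjoint_left.1 hSC)⟩

lemma card_inter_add_card_inter_le {C S : Finset (Fin m)} (hCS : Disjoint C S)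
    (W : Finset (Fin m)) : (C ∩ W).card + (S ∩ W).card ≤ W.card := by
  rw [← Finset.card_union_of_disjoint
    (hCS.mono Finset.inter_subset_left Finset.inter_subset_left)]
  exact Finset.card_le_card (Finset.union_subset Finset.inter_subset_right Finset.inter_subset_right)

/-- A committee consisting of `a` members of `C` and `b` members of `S`. -/
lemma exists_committee_inter_card {C S : Finset (Fin m)} (hCS : Disjoint C S) {a b : ℕ}
    (ha : a ≤ C.card) (hb : b ≤ S.card) (hab : a + b = k) :
    ∃ W : Finset (Fin m), W.card = k ∧ (C ∩ W).card = a ∧ (S ∩ W).card = b := by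
  obtain ⟨D, hDC, hD⟩ := Finset.exists_subset_card_eq ha
  obtain ⟨T, hTS, hT⟩ := Finset.exists_subset_card_eq hb
  refine ⟨D ∪ T, ?_, ?_, ?_⟩
  · rw [Finset.card_union_of_disjoint (hCS.mono hDC hTS), hD, hT, hab]
  · rw [Finset.inter_union_distrib_left, Finset.inter_eq_right.2 hDC,
      Finset.disjoint_iff_inter_eq_empty.1 (hCS.mono_right hTS), Finset.union_empty, hD]
  · rw [Finset.inter_union_distrib_left, Finset.inter_eq_right.2 hTS,
      Finset.disjoint_iff_inter_eq_empty.1 (hCS.symm.mono_right hDC), Finset.empty_union, hT]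

lemma DisjointDiversity.eq_succ (hD : DisjointDiversity m k F) (hF : Implements m k f F)
    (hf : IsCountingFunction m k f) {x y : ℕ} (hx : 1 ≤ x) (hxk : x + 1 ≤ k) (hxy : x + 1 ≤ y)
    (hym : y ≤ m) (hxm : y + k ≤ m + x) : f (x + 1) y = f x y := by
  obtain ⟨C, S, hC, hS, hCS⟩ := exists_disjoint_pair (m := m) (a := y) (b := k - x) (by omega)
  obtain ⟨W', hW', hCW', hSW'⟩ := exists_committee_inter_card (k := k) hCS (a := x + 1)
    (b := k - x - 1) (by omega) (by omega) (by omega)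
  have hbound : ∀ n : ℕ, 0 < n → n * (f (x + 1) y - f x y) ≤ f 1 1 - f 0 1 := by
    intro n hn
    obtain ⟨W, hW, -, hSW, hmax⟩ := hD.exists_committee_cons hF
      (Finset.card_pos.1 (by omega : 0 < C.card)) hCS hn
    have hSW := hSW (by omega)
    have hcard := card_inter_add_card_inter_le hCS W
    have h := hmax W' hW'
    rw [Finset.inter_eq_left.2 hSW] at h hcard
    have hle : f (C ∩ W).card y ≤ f x y := hf _ _ _ (by omega) (by omega) hym
    have hle := mul_le_mul_of_nonneg_left hle n.cast_nonneg
    have hcast : ((k - x : ℕ) : ℝ) = (k - x - 1 : ℕ) + 1 := by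
      rw [← Nat.cast_succ]
      congr 1
      omega
    rw [hCW', hSW', hC, hS, hcast] at h
    linarith
  refine le_antisymm ?_ (hf _ _ _ (by omega) hxk hym)
  by_contra! hlt
  obtain ⟨n, hn⟩ := exists_nat_gt ((f 1 1 - f 0 1) / (f (x + 1) y - f x y))
  have hpos : 0 < f (x + 1) y - f x y := sub_pos.2 hlt
  rw [div_lt_iff₀ hpos] at hn
  have := hbound (n + 1) n.succ_pos
  push_cast at this
  linarith

lemma DisjointDiversity.eq_of_le (hD : DisjointDiversity m k F) (hF : Implements m k f F)
    (hf : IsCountingFunction m k f) {x₀ x y : ℕ} (hx₀ : 1 ≤ x₀) (hx : x₀ ≤ x) (hxk : x ≤ k)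
    (hxy : x ≤ y) (hym : y ≤ m) (hxm : y + k ≤ m + x₀) : f x y = f x₀ y := by
  induction x, hx using Nat.le_induction with
  | base => rfl
  | succ x hx ih =>
    rw [← ih (by omega) (by omega)]
    exact hD.eq_succ hF hf (by omega) hxk hxy hym (by omega)

lemma DisjointDiversity.sub_eq (hD : DisjointDiversity m k F) (hF : Implements m k f F)
    (hf : IsCountingFunction m k f) (hk : 0 < k) {y : ℕ} (hy : 1 ≤ y) (hym : y + k ≤ m) :
    f 1 y - f 0 y = f 1 1 - f 0 1 := by
  obtain ⟨C, S, hC, hS, hCS⟩ := exists_disjoint_pair hym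
  have hCne : C.Nonempty := Finset.card_pos.1 (by omega)
  have hg : 0 ≤ f 1 1 - f 0 1 := sub_nonneg.2 (hf _ _ _ zero_le_one hk (by omega))
  apply le_antisymm
  · obtain ⟨W', hW', hCW', hSW'⟩ := exists_committee_inter_card (k := k) hCS (a := 1)
      (b := k - 1) (by omega) (by omega) (by omega)
    have h := hD.score_le_of_snoc hF hCne hCS hS hW'
    rw [hCW', hSW', hC, Nat.cast_sub hk, Nat.cast_one] at h
    linarith
  · obtain ⟨W, hW, hCW, -, hmax⟩ := hD.exists_committee_cons hF hCne hCS one_pos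
    have hCW := Finset.card_pos.2 (hCW hk)
    have hcard := card_inter_add_card_inter_le hCS W
    have hCle := Finset.card_le_card (Finset.inter_subset_left : C ∩ W ⊆ C)
    have h := hmax S hS
    rw [Finset.disjoint_iff_inter_eq_empty.1 hCS, Finset.inter_self, Finset.card_empty, hC, hS,
      hD.eq_of_le hF hf le_rfl hCW (by omega) (by omega) (by omega) (by omega)] at h
    have hSle : ((S ∩ W).card : ℝ) + 1 ≤ k := by exact_mod_cast (by omega : (S ∩ W).card + 1 ≤ k)
    have := mul_le_mul_of_nonneg_right hSle hg
    push_cast at h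
    linarith

/-- On the attainable pairs `(x, y)`, `f` is an affine transformation of `fCC` for each `y`, with
a slope that does not depend on `y`. -/
lemma DisjointDiversity.exists_eq_add_mul_fCC (hD : DisjointDiversity m k F)
    (hF : Implements m k f F) (hf : IsCountingFunction m k f) (hk : 0 < k) (y : ℕ) :
    ∃ b : ℝ, ∀ x, x ≤ k → x ≤ y → y ≤ m → y + k ≤ m + x →
      f x y = b + (f 1 1 - f 0 1) * fCC x y := by
  rcases le_or_gt (y + k) m with hym | hym
  · refine ⟨f 0 y, fun x hxk hxy hy _ => ?_⟩
    rcases Nat.eq_zero_or_pos x with rfl | hx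
    · simp [fCC]
    · rw [hD.eq_of_le hF hf le_rfl hx hxk hxy hy (by omega),
        ← hD.sub_eq hF hf hk (by omega : 1 ≤ y) hym]
      simp [fCC, hx.ne']
  · refine ⟨f (y + k - m) y - (f 1 1 - f 0 1), fun x hxk hxy hy hx => ?_⟩
    rw [hD.eq_of_le hF hf (by omega : 1 ≤ y + k - m) (by omega) hxk hxy hy (by omega)]
    have hx0 : x ≠ 0 := by omega
    simp [fCC, hx0]

lemma DisjointDiversity.exists_score_eq (hD : DisjointDiversity m k F)
    (hF : Implements m k f F) (hf : IsCountingFunction m k f) (hk : 0 < k) (A : Profile m) :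
    ∃ b : ℝ, ∀ W : Finset (Fin m), W.card = k →
      score f W A = b + (f 1 1 - f 0 1) * score fCC W A := by
  choose b hb using hD.exists_eq_add_mul_fCC hF hf hk
  refine ⟨(A.map fun s => b s.card).sum, fun W hW => ?_⟩
  rw [score, score, ← List.sum_map_mul_left, ← List.sum_map_add]
  refine congrArg List.sum (List.map_congr_left fun s _ => ?_)
  have hunion := Finset.card_union_add_card_inter s W
  have hle : (s ∪ W).card ≤ m := by simpa using Finset.card_le_univ (s ∪ W)
  refine hb _ _ (hW ▸ Finset.card_le_card Finset.inter_subset_right)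
    (Finset.card_le_card Finset.inter_subset_left) (by simpa using Finset.card_le_univ s) ?_
  omega

end Uniqueness

/-- the Approval Chamberlin–Courant rule is the only non-trivial
ABC counting rule satisfying disjoint diversity. -/
theorem statement7 (m k : ℕ) (hk : 0 < k) (hkm : k < m) :
    (∀ F : ABCRankingRule m k, Implements m k fCC F →
      DisjointDiversity m k F ∧ ¬ IsTrivialRule m k F) ∧
    (∀ F : ABCRankingRule m k, IsCountingRule m k F → ¬ IsTrivialRule m k F →
      DisjointDiversity m k F →
      ∀ (A : Profile m) (W1 W2 : Finset (Fin m)), W1.card = k → W2.card = k →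
        (F.strict A W1 W2 ↔ score fCC W2 A < score fCC W1 A)) := by
  refine ⟨fun F hF => ⟨disjointDiversity_of_implements_fCC hkm.le hF,
    not_isTrivialRule_of_implements_fCC hk hkm hF⟩, ?_⟩
  rintro F ⟨f, hf, hF⟩ hnontriv hD A W1 W2 hW1 hW2
  have hslope : 0 < f 1 1 - f 0 1 := by
    refine lt_of_le_of_ne (sub_nonneg.2 (hf _ _ _ zero_le_one hk (by omega))) fun h0 => ?_
    refine hnontriv fun A W W' hW hW' => (hF.rel_iff_s7 hW hW').2 ?_
    obtain ⟨b, hb⟩ := hD.exists_score_eq hF hf hk A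
    rw [hb W hW, hb W' hW', ← h0, zero_mul, zero_mul]
  obtain ⟨b, hb⟩ := hD.exists_score_eq hF hf hk A
  rw [← hF A W1 W2 hW1 hW2, hb W1 hW1, hb W2 hW2, add_lt_add_iff_left,
    mul_lt_mul_iff_right₀ hslope]

end ABC
end
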